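/- In the setting of the tube T_ε(Λ), define H_ε(v) := L_ε^{-1}( (ε²Δu_ε + λe^{u_ε}) + λe^{u_ε}(e^v − 1 − v) ) for bounded functions v on T_ε(Λ), where L_ε = −(ε²Δ + λe^{u_ε}) with Dirichlet boundary conditions is invertible for small ε. Then there exist constants C' > 0 and ε₀ > 0 such that for all ε ∈ (0,ε₀) and all f, g in the set 𝒜_ε := {v ∈ L^∞(T_ε(Λ)) : ‖v‖_∞ ≤ Cε}, one has ‖H_ε(f) − H_ε(g)‖_{L^∞(T_ε(Λ))} ≤ C'·ε·‖f − g‖_{L^∞(T_ε(Λ))}; in particular H_ε maps 𝒜_ε into itself and is a contraction there for small ε. -/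

import Mathlib

open Real MeasureTheory Metric Set Filter

noncomputable section

/-- The Euclidean Laplacian of `f : ℝⁿ → ℝ` at `x`. -/
def lap {n : ℕ} (f : EuclideanSpace ℝ (Fin n) → ℝ) (x : EuclideanSpace ℝ (Fin n)) : ℝ :=
  ∑ i : Fin n, iteratedFDeriv ℝ 2 f x ![EuclideanSpace.single i 1, EuclideanSpace.single i 1]

/-- The tubular neighbourhood of radius `ε` about a set `Λ ⊆ ℝⁿ`. -/
def tube {n : ℕ} (Λ : Set (EuclideanSpace ℝ (Fin n))) (ε : ℝ) : Set (EuclideanSpace ℝ (Fin n)) :=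
  {x | Metric.infDist x Λ < ε}

open scoped Topology ContDiff

section Laplacian

variable {n : ℕ}

theorem lap_eq_sum_fderiv (f : EuclideanSpace ℝ (Fin n) → ℝ) (x : EuclideanSpace ℝ (Fin n)) :
    lap f x = ∑ i, fderiv ℝ (fderiv ℝ f) x (EuclideanSpace.single i 1)
      (EuclideanSpace.single i 1) := by
  simp [lap, iteratedFDeriv_two_apply]

theorem lap_of_hasFDerivAt {f : EuclideanSpace ℝ (Fin n) → ℝ} {x : EuclideanSpace ℝ (Fin n)}
    {A : EuclideanSpace ℝ (Fin n) → EuclideanSpace ℝ (Fin n) →L[ℝ] ℝ}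
    {A' : EuclideanSpace ℝ (Fin n) →L[ℝ] EuclideanSpace ℝ (Fin n) →L[ℝ] ℝ}
    (h : ∀ᶠ y in 𝓝 x, HasFDerivAt f (A y) y) (hA : HasFDerivAt A A' x) :
    lap f x = ∑ i, A' (EuclideanSpace.single i 1) (EuclideanSpace.single i 1) := by
  have h1 : fderiv ℝ f =ᶠ[𝓝 x] A := h.mono fun y hy => hy.fderiv
  rw [lap_eq_sum_fderiv, h1.fderiv_eq, hA.fderiv]

theorem lap_congr {f g : EuclideanSpace ℝ (Fin n) → ℝ} {x : EuclideanSpace ℝ (Fin n)}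
    (h : f =ᶠ[𝓝 x] g) : lap f x = lap g x := by
  rw [lap_eq_sum_fderiv, lap_eq_sum_fderiv, h.fderiv.fderiv_eq]

theorem eventually_hasFDerivAt {f : EuclideanSpace ℝ (Fin n) → ℝ} {x : EuclideanSpace ℝ (Fin n)}
    (hf : ContDiffAt ℝ 2 f x) :
    ∀ᶠ y in 𝓝 x, HasFDerivAt f (fderiv ℝ f y) y :=
  (hf.eventually (by simp)).mono fun _ hy => (hy.differentiableAt (by norm_num)).hasFDerivAt

theorem hasFDerivAt_fderiv {f : EuclideanSpace ℝ (Fin n) → ℝ} {x : EuclideanSpace ℝ (Fin n)}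
    (hf : ContDiffAt ℝ 2 f x) :
    HasFDerivAt (fderiv ℝ f) (fderiv ℝ (fderiv ℝ f) x) x :=
  ((hf.fderiv_right (m := 1) (by norm_num)).differentiableAt (by norm_num)).hasFDerivAt

theorem lap_sub {f g : EuclideanSpace ℝ (Fin n) → ℝ} {x : EuclideanSpace ℝ (Fin n)}
    (hf : ContDiffAt ℝ 2 f x) (hg : ContDiffAt ℝ 2 g x) :
    lap (fun y => f y - g y) x = lap f x - lap g x := by
  rw [lap_of_hasFDerivAt (A := fun y => fderiv ℝ f y - fderiv ℝ g y)
    (A' := fderiv ℝ (fderiv ℝ f) x - fderiv ℝ (fderiv ℝ g) x) ?_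
    ((hasFDerivAt_fderiv hf).sub (hasFDerivAt_fderiv hg))]
  · simp [lap_eq_sum_fderiv, Finset.sum_sub_distrib]
  · filter_upwards [eventually_hasFDerivAt hf, eventually_hasFDerivAt hg] with y h1 h2
    exact h1.sub h2

theorem lap_mul {f g : EuclideanSpace ℝ (Fin n) → ℝ} {x : EuclideanSpace ℝ (Fin n)}
    (hf : ContDiffAt ℝ 2 f x) (hg : ContDiffAt ℝ 2 g x) :
    lap (fun y => f y * g y) x = f x * lap g x + g x * lap f x +
      2 * ∑ i, fderiv ℝ f x (EuclideanSpace.single i 1) *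
        fderiv ℝ g x (EuclideanSpace.single i 1) := by
  have hf0 := (hf.differentiableAt (by norm_num)).hasFDerivAt
  have hg0 := (hg.differentiableAt (by norm_num)).hasFDerivAt
  rw [lap_of_hasFDerivAt (A := fun y => f y • fderiv ℝ g y + g y • fderiv ℝ f y) ?_
    ((hf0.smul (hasFDerivAt_fderiv hg)).add (hg0.smul (hasFDerivAt_fderiv hf)))]
  · simp only [lap_eq_sum_fderiv, Finset.mul_sum, ← Finset.sum_add_distrib]
    refine Finset.sum_congr rfl fun i _ => ?_
    simp only [add_apply, smul_apply,
      ContinuousLinearMap.smulRight_apply, smul_eq_mul]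
    ring
  · filter_upwards [eventually_hasFDerivAt hf, eventually_hasFDerivAt hg] with y h1 h2
    exact h1.mul h2

theorem lap_comp {f : EuclideanSpace ℝ (Fin n) → ℝ} {x : EuclideanSpace ℝ (Fin n)} {φ φ' :
    ℝ → ℝ} {φ'' : ℝ} (hf : ContDiffAt ℝ 2 f x)
    (hφ : ∀ t, HasDerivAt φ (φ' t) t) (hφ' : HasDerivAt φ' φ'' (f x)) :
    lap (fun y => φ (f y)) x = φ'' * ∑ i, fderiv ℝ f x (EuclideanSpace.single i 1) ^ 2 +
      φ' (f x) * lap f x := by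
  have hf0 := (hf.differentiableAt (by norm_num)).hasFDerivAt
  rw [lap_of_hasFDerivAt (A := fun y => φ' (f y) • fderiv ℝ f y) ?_
    ((hφ'.comp_hasFDerivAt x hf0).smul (hasFDerivAt_fderiv hf))]
  · simp only [lap_eq_sum_fderiv, Finset.mul_sum, ← Finset.sum_add_distrib]
    refine Finset.sum_congr rfl fun i _ => ?_
    simp only [add_apply, smul_apply,
      ContinuousLinearMap.smulRight_apply, smul_eq_mul, Function.comp]
    ring
  · filter_upwards [eventually_hasFDerivAt hf] with y h1
    exact (hφ (f y)).comp_hasFDerivAt y h1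

theorem continuousAt_lap {f : EuclideanSpace ℝ (Fin n) → ℝ} {x : EuclideanSpace ℝ (Fin n)}
    (hf : ContDiffAt ℝ 2 f x) :
    ContinuousAt (lap f) x := by
  have h1 : ContDiffAt ℝ 0 (fderiv ℝ (fderiv ℝ f)) x :=
    (hf.fderiv_right (m := 1) (by norm_num)).fderiv_right (m := 0) (by norm_num)
  have h2 := h1.continuousAt
  rw [funext (lap_eq_sum_fderiv f)]
  exact tendsto_finsetSum _ fun i _ =>
    (h2.clm_apply continuousAt_const).clm_apply continuousAt_const

theorem sum_inner_single_mul (z : EuclideanSpace ℝ (Fin n)) (L : EuclideanSpace ℝ (Fin n) →L[ℝ] ℝ) :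
    ∑ i, inner ℝ z (EuclideanSpace.single i (1 : ℝ)) * L (EuclideanSpace.single i 1) = L z := by
  have h := (EuclideanSpace.basisFun (Fin n) ℝ).sum_repr z
  conv_rhs => rw [← h]
  simp [EuclideanSpace.inner_single_right]

end Laplacian

/-- The radial average `ρ ↦ ∫₀¹ sᵐ g(ρ s²) ds`. -/
def radAvg (m : ℕ) (g : ℝ → ℝ) (ρ : ℝ) : ℝ := ∫ s in (0 : ℝ)..1, s ^ m * g (ρ * s ^ 2)

theorem continuous_radAvg (m : ℕ) {g : ℝ → ℝ} (hg : Continuous g) : Continuous (radAvg m g) := by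
  unfold radAvg
  apply intervalIntegral.continuous_parametric_intervalIntegral_of_continuous'
  simp only [Function.uncurry_def]
  fun_prop

theorem hasDerivAt_radAvg (m : ℕ) {g : ℝ → ℝ} (hg : ContDiff ℝ 1 g) (ρ : ℝ) :
    HasDerivAt (radAvg m g) (radAvg (m + 2) (deriv g) ρ) ρ := by
  have hg' : Continuous (deriv g) := hg.continuous_deriv le_rfl
  have hgc : Continuous g := hg.continuous
  have hd : Differentiable ℝ g := hg.differentiable (by norm_num)
  obtain ⟨B, hB⟩ := (isCompact_Icc (a := -(|ρ| + 1)) (b := |ρ| + 1)).exists_bound_of_continuousOn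
    hg'.continuousOn
  unfold radAvg
  refine (intervalIntegral.hasDerivAt_integral_of_dominated_loc_of_deriv_le
    (F := fun x s => s ^ m * g (x * s ^ 2)) (F' := fun x s => s ^ (m + 2) * deriv g (x * s ^ 2))
    (s := ball ρ 1) (bound := fun _ => B) (ball_mem_nhds ρ one_pos) ?_ ?_ ?_ ?_ ?_ ?_).2
  · exact Eventually.of_forall fun x => (by fun_prop : Continuous _).aestronglyMeasurable
  · exact (by fun_prop : Continuous _).intervalIntegrable _ _
  · exact (by fun_prop : Continuous _).aestronglyMeasurable
  · refine Eventually.of_forall fun s hs x hx => ?_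
    rw [uIoc_of_le zero_le_one] at hs
    have hx' : |x| ≤ |ρ| + 1 := by
      have h1 : |x - ρ| < 1 := by simpa [Real.dist_eq] using hx
      have h2 := abs_add_le (x - ρ) ρ
      rw [sub_add_cancel] at h2
      linarith
    have hs2 : s ^ 2 ≤ 1 := by nlinarith [hs.1, hs.2]
    have hxs : |x * s ^ 2| ≤ |ρ| + 1 := by
      rw [abs_mul, abs_of_nonneg (sq_nonneg s)]
      nlinarith [abs_nonneg x, sq_nonneg s]
    have h1 := hB (x * s ^ 2) (abs_le.mp hxs)
    rw [norm_mul, Real.norm_of_nonneg (pow_nonneg hs.1.le _)]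
    have h3 : s ^ (m + 2) ≤ 1 := pow_le_one₀ hs.1.le hs.2
    have h4 : 0 ≤ s ^ (m + 2) := pow_nonneg hs.1.le _
    nlinarith [norm_nonneg (deriv g (x * s ^ 2))]
  · exact intervalIntegrable_const
  · refine Eventually.of_forall fun s hs x hx => ?_
    have h1 : HasDerivAt (fun x => x * s ^ 2) (s ^ 2) x := by
      simpa using (hasDerivAt_id x).mul_const (s ^ 2)
    have h2 := ((hd (x * s ^ 2)).hasDerivAt.comp x h1).const_mul (s ^ m)
    refine h2.congr_deriv ?_
    ring

theorem contDiff_radAvg (k : ℕ) : ∀ (m : ℕ) {g : ℝ → ℝ}, ContDiff ℝ k g →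
    ContDiff ℝ k (radAvg m g) := by
  induction k with
  | zero =>
    intro m g hg
    have := continuous_radAvg m (contDiff_zero.mp (by exact_mod_cast hg))
    exact_mod_cast contDiff_zero.mpr this
  | succ k ih =>
    intro m g hg
    have h1 : ContDiff ℝ 1 g := hg.of_le (by exact_mod_cast Nat.le_add_left 1 k)
    have hder : deriv (radAvg m g) = radAvg (m + 2) (deriv g) :=
      funext fun ρ => (hasDerivAt_radAvg m h1 ρ).deriv
    push_cast at hg ⊢
    rw [contDiff_succ_iff_deriv] at hg ⊢
    refine ⟨fun ρ => (hasDerivAt_radAvg m h1 ρ).differentiableAt, by simp, ?_⟩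
    rw [hder]
    exact ih _ hg.2.2

theorem radAvg_ode (m : ℕ) {g : ℝ → ℝ} (hg : ContDiff ℝ 1 g) (ρ : ℝ) :
    2 * ρ * deriv (radAvg m g) ρ + (m + 1) * radAvg m g ρ = g ρ := by
  have hg' : Continuous (deriv g) := hg.continuous_deriv le_rfl
  have hgc : Continuous g := hg.continuous
  have hd : Differentiable ℝ g := hg.differentiable (by norm_num)
  rw [(hasDerivAt_radAvg m hg ρ).deriv]
  have hder : ∀ s ∈ uIcc (0 : ℝ) 1, HasDerivAt (fun s => s ^ (m + 1) * g (ρ * s ^ 2))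
      (2 * ρ * (s ^ (m + 2) * deriv g (ρ * s ^ 2)) + (m + 1) * (s ^ m * g (ρ * s ^ 2))) s := by
    intro s _
    have h1 : HasDerivAt (fun s : ℝ => ρ * s ^ 2) (ρ * (2 * s)) s := by
      simpa using (hasDerivAt_pow 2 s).const_mul ρ
    have h2 := (hasDerivAt_pow (m + 1) s).mul ((hd (ρ * s ^ 2)).hasDerivAt.comp s h1)
    refine h2.congr_deriv ?_
    simp only [Function.comp, Nat.add_sub_cancel]
    push_cast
    ring
  have h := intervalIntegral.integral_eq_sub_of_hasDerivAt hder
    ((by fun_prop : Continuous _).intervalIntegrable _ _)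
  rw [intervalIntegral.integral_add ((by fun_prop : Continuous _).intervalIntegrable _ _)
    ((by fun_prop : Continuous _).intervalIntegrable _ _),
    intervalIntegral.integral_const_mul, intervalIntegral.integral_const_mul] at h
  simpa [radAvg] using h

theorem radAvg_congr (m : ℕ) {g₁ g₂ : ℝ → ℝ} {c ρ : ℝ} (h : EqOn g₁ g₂ (Icc 0 c))
    (hρ : ρ ∈ Icc 0 c) : radAvg m g₁ ρ = radAvg m g₂ ρ := by
  unfold radAvg
  refine intervalIntegral.integral_congr fun s hs => ?_
  rw [uIcc_of_le zero_le_one] at hs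
  have hs2 : s ^ 2 ≤ 1 := by nlinarith [hs.1, hs.2]
  have : ρ * s ^ 2 ∈ Icc 0 c :=
    ⟨mul_nonneg hρ.1 (sq_nonneg s), by nlinarith [hρ.1, hρ.2, sq_nonneg s]⟩
  simp only [h this]

theorem radAvg_pos (m : ℕ) {g : ℝ → ℝ} (hg : Continuous g) (hpos : ∀ t, 0 < g t) (ρ : ℝ) :
    0 < radAvg m g ρ := by
  unfold radAvg
  refine intervalIntegral.intervalIntegral_pos_of_pos_on
    ((by fun_prop : Continuous _).intervalIntegrable _ _) (fun s hs => ?_) one_pos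
  exact mul_pos (pow_pos hs.1 _) (hpos _)

/-- Positivity for the first order singular equation `2ρX' + dX = g`. -/
theorem singular_ode_pos {d : ℕ} (hd : 1 ≤ d) {X X' g : ℝ → ℝ} {c : ℝ} (hc : 0 < c)
    (hX : ∀ ρ, HasDerivAt X (X' ρ) ρ)
    (hode : ∀ ρ ∈ Ioo 0 c, 2 * ρ * X' ρ + d * X ρ = g ρ) (hg : ∀ ρ ∈ Ioo 0 c, 0 < g ρ) :
    0 < X c := by
  have hder : ∀ r : ℝ, HasDerivAt (fun r : ℝ => r ^ d * X (r ^ 2 / 2))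
      (d * r ^ (d - 1) * X (r ^ 2 / 2) + r ^ d * (X' (r ^ 2 / 2) * r)) r := by
    intro r
    have h1 : HasDerivAt (fun r : ℝ => r ^ 2 / 2) r r := by
      refine ((hasDerivAt_pow 2 r).div_const 2).congr_deriv ?_
      simp
    exact (hasDerivAt_pow d r).mul ((hX (r ^ 2 / 2)).comp r h1)
  have hmono : StrictMonoOn (fun r : ℝ => r ^ d * X (r ^ 2 / 2)) (Icc 0 (√(2 * c))) := by
    refine strictMonoOn_of_deriv_pos (convex_Icc _ _)
      (fun r _ => (hder r).continuousAt.continuousWithinAt) fun r hr => ?_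
    rw [interior_Icc] at hr
    rw [(hder r).deriv]
    have hr2 : r ^ 2 < 2 * c := by
      have := Real.sq_sqrt (show 0 ≤ 2 * c by linarith)
      nlinarith [hr.1, hr.2]
    have hmem : r ^ 2 / 2 ∈ Ioo 0 c := ⟨by have := hr.1; positivity, by linarith⟩
    have h1 := hode _ hmem
    have h2 := hg _ hmem
    obtain ⟨e, rfl⟩ : ∃ e, d = e + 1 := ⟨d - 1, by omega⟩
    have : ((e + 1 : ℕ) : ℝ) * r ^ (e + 1 - 1) * X (r ^ 2 / 2) + r ^ (e + 1) * (X' (r ^ 2 / 2) * r)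
        = r ^ e * g (r ^ 2 / 2) := by
      rw [← h1, Nat.add_sub_cancel]; ring
    rw [this]
    exact mul_pos (pow_pos hr.1 _) h2
  have hs : 0 < √(2 * c) := Real.sqrt_pos.mpr (by linarith)
  have h := hmono (left_mem_Icc.mpr hs.le) (right_mem_Icc.mpr hs.le) hs
  simp only [Real.sq_sqrt (show 0 ≤ 2 * c by linarith)] at h
  rw [zero_pow (by omega), zero_mul, mul_div_cancel_left₀ c two_ne_zero] at h
  exact pos_of_mul_pos_right h (pow_pos hs d).le

/-- Nonnegativity for the first order singular equation `2ρX' + dX = g`. -/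
theorem singular_ode_nonneg {d : ℕ} (hd : 1 ≤ d) {X X' g : ℝ → ℝ} {c : ℝ} (hc : 0 < c)
    (hX : ∀ ρ, HasDerivAt X (X' ρ) ρ)
    (hode : ∀ ρ ∈ Ioo 0 c, 2 * ρ * X' ρ + d * X ρ = g ρ) (hg : ∀ ρ ∈ Ioo 0 c, 0 ≤ g ρ) :
    0 ≤ X c := by
  refine le_of_forall_pos_lt_add fun η hη => ?_
  refine singular_ode_pos hd hc (X := fun ρ => X ρ + η) (X' := X') (g := fun ρ => g ρ + d * η)
    (fun ρ => (hX ρ).add_const η) (fun ρ hρ => ?_) (fun ρ hρ => ?_)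
  · rw [← hode ρ hρ]; ring
  · have := hg ρ hρ
    have : (0 : ℝ) < d := by exact_mod_cast hd
    positivity

theorem eq_of_hasDerivAt_zero {f : ℝ → ℝ} {b : ℝ} (hb : 0 ≤ b) (hf : ContinuousOn f (Icc 0 b))
    (hf' : ∀ x ∈ Ioo 0 b, HasDerivAt f 0 x) : f b = f 0 := by
  rcases hb.eq_or_lt with rfl | hb
  · rfl
  obtain ⟨c, -, hc⟩ := exists_hasDerivAt_eq_slope f (fun _ => 0) hb hf hf'
  have h := (eq_div_iff (by linarith : b - 0 ≠ 0)).mp hc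
  linarith

theorem iteratedFDeriv_two_line {E : Type*} [NormedAddCommGroup E] [NormedSpace ℝ E]
    {f : E → ℝ} {x : E} (hf : ContDiffAt ℝ 2 f x) (e : E) :
    iteratedFDeriv ℝ 2 f x ![e, e] = deriv (deriv fun s : ℝ => f (x + s • e)) 0 := by
  have hline : ∀ s : ℝ, HasDerivAt (fun s : ℝ => x + s • e) e s := fun s => by
    simpa using ((hasDerivAt_id s).smul_const e).const_add x
  have hx : Tendsto (fun s : ℝ => x + s • e) (𝓝 0) (𝓝 x) := by
    simpa using (hline 0).continuousAt.tendsto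
  have h1 : (deriv fun s : ℝ => f (x + s • e)) =ᶠ[𝓝 0] fun s => fderiv ℝ f (x + s • e) e := by
    have := hx.eventually (hf.eventually (by simp))
    filter_upwards [this] with s hs
    exact ((hs.differentiableAt (by norm_num)).hasFDerivAt.comp_hasDerivAt s (hline s)).deriv
  rw [iteratedFDeriv_two_apply, h1.deriv_eq]
  have h2 : HasFDerivAt (fderiv ℝ f) (fderiv ℝ (fderiv ℝ f) x) (x + (0 : ℝ) • e) := by
    rw [zero_smul, add_zero]
    exact ((hf.fderiv_right (m := 1) (by norm_num)).differentiableAt (by norm_num)).hasFDerivAt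
  have h3 := h2.comp_hasDerivAt 0 (hline 0)
  have h4 := h3.clm_apply (hasDerivAt_const (0 : ℝ) e)
  have h5 := h4.deriv
  simp only [Function.comp_def, map_zero, add_zero] at h5
  simpa using h5.symm

theorem pow_mul_radAvg (m : ℕ) (g : ℝ → ℝ) (r : ℝ) :
    r ^ (m + 1) * radAvg m g (r ^ 2 / 2) = ∫ t in (0 : ℝ)..r, t ^ m * g (t ^ 2 / 2) := by
  have h := intervalIntegral.smul_integral_comp_mul_left (a := 0) (b := 1)
    (fun t : ℝ => t ^ m * g (t ^ 2 / 2)) r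
  rw [mul_zero, mul_one] at h
  rw [← h, radAvg, smul_eq_mul, pow_succ', mul_assoc, ← intervalIntegral.integral_const_mul]
  congr 1
  refine intervalIntegral.integral_congr fun s _ => ?_
  simp only [mul_pow]
  rw [← mul_assoc, show r ^ 2 / 2 * s ^ 2 = r ^ 2 * s ^ 2 / 2 by ring]

/-- The Laplacian of a radial function on the first coordinate axis. -/
theorem lap_radial {d : ℕ} (hd : 1 ≤ d) {F : EuclideanSpace ℝ (Fin d) → ℝ} {y : ℝ → ℝ} {r : ℝ}
    (hr : 0 < r) (hrad : ∀ z, F z = y ‖z‖)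
    (hF : ContDiffAt ℝ 2 F (r • EuclideanSpace.single (⟨0, hd⟩ : Fin d) (1 : ℝ)))
    (hy : ContDiffAt ℝ 2 y r) :
    lap F (r • EuclideanSpace.single (⟨0, hd⟩ : Fin d) (1 : ℝ)) =
      deriv (deriv y) r + (d - 1) * (deriv y r / r) := by
  set i₀ : Fin d := ⟨0, hd⟩
  unfold lap
  have h0 : iteratedFDeriv ℝ 2 F (r • EuclideanSpace.single i₀ (1 : ℝ))
      ![EuclideanSpace.single i₀ 1, EuclideanSpace.single i₀ 1] = deriv (deriv y) r := by
    rw [iteratedFDeriv_two_line hF]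
    have h1 : (fun s : ℝ => F (r • EuclideanSpace.single i₀ (1 : ℝ) +
        s • EuclideanSpace.single i₀ (1 : ℝ))) =ᶠ[𝓝 0] fun s => y (r + s) := by
      filter_upwards [lt_mem_nhds (show -r < 0 by linarith)] with s hs
      rw [hrad, ← add_smul, norm_smul]
      simp [abs_of_pos (show 0 < r + s by linarith)]
    rw [h1.deriv.deriv_eq]
    have h2 : (deriv fun s => y (r + s)) = fun s => deriv y (r + s) :=
      funext fun s => deriv_comp_const_add _ _ _
    rw [h2, deriv_comp_const_add, add_zero]
  have h1 : ∀ i, i ≠ i₀ → iteratedFDeriv ℝ 2 F (r • EuclideanSpace.single i₀ (1 : ℝ))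
      ![EuclideanSpace.single i 1, EuclideanSpace.single i 1] = deriv y r / r := by
    intro i hi
    rw [iteratedFDeriv_two_line hF]
    have h2 : (fun s : ℝ => F (r • EuclideanSpace.single i₀ (1 : ℝ) +
        s • EuclideanSpace.single i (1 : ℝ))) = fun s => y (√(r ^ 2 + s ^ 2)) := by
      funext s
      rw [hrad]
      congr 1
      rw [eq_comm, Real.sqrt_eq_iff_mul_self_eq (by positivity) (norm_nonneg _),
        ← real_inner_self_eq_norm_mul_norm]
      simp only [inner_add_left, inner_add_right, inner_smul_left, inner_smul_right]
      simp [EuclideanSpace.inner_single_left, hi, Ne.symm hi]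
      ring
    rw [h2]
    have hsq : ∀ s : ℝ, HasDerivAt (fun s : ℝ => √(r ^ 2 + s ^ 2)) (s / √(r ^ 2 + s ^ 2)) s := by
      intro s
      have hp : 0 < r ^ 2 + s ^ 2 := by positivity
      refine (((hasDerivAt_pow 2 s).const_add (r ^ 2)).sqrt hp.ne').congr_deriv ?_
      have := Real.sqrt_pos.mpr hp
      field_simp
      ring
    have hr0 : √(r ^ 2 + (0 : ℝ) ^ 2) = r := by
      rw [zero_pow two_ne_zero, add_zero, Real.sqrt_sq hr.le]
    have ht : Tendsto (fun s : ℝ => √(r ^ 2 + s ^ 2)) (𝓝 0) (𝓝 r) := by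
      have := (hsq 0).continuousAt.tendsto
      rwa [hr0] at this
    have h3 : (deriv fun s => y (√(r ^ 2 + s ^ 2))) =ᶠ[𝓝 0]
        fun s => deriv y (√(r ^ 2 + s ^ 2)) * (s / √(r ^ 2 + s ^ 2)) := by
      filter_upwards [ht.eventually (hy.eventually (by simp))] with s hs
      exact ((hs.differentiableAt (by norm_num)).hasDerivAt.comp s (hsq s)).deriv
    rw [h3.deriv_eq]
    have h4 : HasDerivAt (deriv y) (deriv (deriv y) r) (√(r ^ 2 + (0 : ℝ) ^ 2)) := by
      rw [hr0]
      have : ContDiffAt ℝ 1 (deriv y) r :=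
        (hy.fderiv_right (m := 1) (by norm_num)).clm_apply contDiffAt_const
      exact (this.differentiableAt (by norm_num)).hasDerivAt
    have h5 := (h4.comp 0 (hsq 0)).mul ((hasDerivAt_id (0 : ℝ)).div (hsq 0)
      (by rw [hr0]; exact hr.ne'))
    have h6 := h5.deriv
    simp only [Function.comp_def, id, hr0] at h6
    refine (Eq.trans ?_ h6).trans ?_
    · rfl
    · field_simp
      ring
  rw [← Finset.add_sum_erase _ _ (Finset.mem_univ i₀), h0,
    Finset.sum_congr rfl fun i hi => h1 i (Finset.ne_of_mem_erase hi), Finset.sum_const,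
    Finset.card_erase_of_mem (Finset.mem_univ _), Finset.card_univ, Fintype.card_fin,
    nsmul_eq_mul, Nat.cast_sub hd, Nat.cast_one]

/-- A radial solution of `Δ F + g(|z|²/2) = 0` in the ball is an explicit double integral. -/
theorem radial_profile {d : ℕ} (hd : 2 ≤ d) {F : EuclideanSpace ℝ (Fin d) → ℝ} {F₀ : ℝ → ℝ}
    (hrad : ∀ z, F z = F₀ ‖z‖) (hF : ContDiffOn ℝ 2 F (closedBall 0 1)) {g : ℝ → ℝ}
    (hg : Continuous g) (hsol : ∀ z ∈ ball 0 1, lap F z + g (‖z‖ ^ 2 / 2) = 0) :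
    ∀ r ∈ Ico (0 : ℝ) 1, F₀ r = F₀ 0 - ∫ t in (0 : ℝ)..(r ^ 2 / 2), radAvg (d - 1) g t := by
  have hd1 : 1 ≤ d := by omega
  set e : EuclideanSpace ℝ (Fin d) := EuclideanSpace.single (⟨0, hd1⟩ : Fin d) (1 : ℝ) with he
  have hnorm : ∀ r : ℝ, ‖r • e‖ = |r| := fun r => by simp [he, norm_smul]
  have hFat : ∀ z ∈ ball (0 : EuclideanSpace ℝ (Fin d)) 1, ContDiffAt ℝ 2 F z := fun z hz =>
    hF.contDiffAt (mem_of_superset (isOpen_ball.mem_nhds hz) ball_subset_closedBall)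
  have hmem : ∀ r ∈ Ioo (-1 : ℝ) 1, r • e ∈ ball (0 : EuclideanSpace ℝ (Fin d)) 1 := by
    intro r hr
    rw [mem_ball_zero_iff, hnorm]
    exact abs_lt.mpr hr
  set y : ℝ → ℝ := fun r => F (r • e) with hydef
  have hy : ∀ r ∈ Ioo (-1 : ℝ) 1, ContDiffAt ℝ 2 y r := fun r hr =>
    (hFat _ (hmem r hr)).comp r (contDiff_id.smul contDiff_const).contDiffAt
  have hyF : ∀ r, 0 ≤ r → y r = F₀ r := fun r hr => by
    simp only [hydef]; rw [hrad, hnorm, abs_of_nonneg hr]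
  have hyrad : ∀ z, F z = y ‖z‖ := fun z => by rw [hrad, hyF _ (norm_nonneg z)]
  have hy1 : ∀ r ∈ Ioo (-1 : ℝ) 1, HasDerivAt y (deriv y r) r := fun r hr =>
    ((hy r hr).differentiableAt (by norm_num)).hasDerivAt
  have hy2 : ∀ r ∈ Ioo (-1 : ℝ) 1, HasDerivAt (deriv y) (deriv (deriv y) r) r := fun r hr => by
    have : ContDiffAt ℝ 1 (deriv y) r :=
      ((hy r hr).fderiv_right (m := 1) (by norm_num)).clm_apply contDiffAt_const
    exact (this.differentiableAt (by norm_num)).hasDerivAt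
  obtain ⟨k, rfl⟩ : ∃ k, d = k + 2 := ⟨d - 2, by omega⟩
  have hode : ∀ r ∈ Ioo (0 : ℝ) 1,
      deriv (deriv y) r + (k + 1) * (deriv y r / r) + g (r ^ 2 / 2) = 0 := by
    intro r hr
    have hr' : r ∈ Ioo (-1 : ℝ) 1 := ⟨by linarith [hr.1], hr.2⟩
    have h1 := hsol _ (hmem r hr')
    rw [hnorm, sq_abs, lap_radial hd1 hr.1 hyrad (hFat _ (hmem r hr')) (hy r hr')] at h1
    push_cast at h1
    linarith
  have hkint : ∀ r : ℝ, HasDerivAt (fun r : ℝ => ∫ t in (0 : ℝ)..r, t ^ (k + 1) * g (t ^ 2 / 2))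
      (r ^ (k + 1) * g (r ^ 2 / 2)) r := fun r =>
    (by fun_prop : Continuous fun t : ℝ => t ^ (k + 1) * g (t ^ 2 / 2)).integral_hasStrictDerivAt
      0 r |>.hasDerivAt
  have hfirst : ∀ r ∈ Ioo (0 : ℝ) 1, deriv y r = -(r * radAvg (k + 1) g (r ^ 2 / 2)) := by
    intro r hr
    have hz := eq_of_hasDerivAt_zero (b := r)
      (f := fun r => r ^ (k + 1) * deriv y r + ∫ t in (0 : ℝ)..r, t ^ (k + 1) * g (t ^ 2 / 2))
      hr.1.le (fun s hs => ?_) (fun s hs => ?_)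
    · simp only [intervalIntegral.integral_same, zero_pow (Nat.succ_ne_zero k), zero_mul,
        add_zero] at hz
      rw [← pow_mul_radAvg] at hz
      have h0 : r ^ (k + 1) * (deriv y r + r * radAvg (k + 1) g (r ^ 2 / 2)) = 0 := by
        rw [← hz]; ring
      rcases mul_eq_zero.mp h0 with h | h
      · exact absurd h (pow_pos hr.1 _).ne'
      · linarith
    · have hs' : s ∈ Ioo (-1 : ℝ) 1 := ⟨by linarith [hs.1], by linarith [hs.2, hr.2]⟩
      exact (((hasDerivAt_pow (k + 1) s).mul (hy2 s hs')).add
        (hkint s)).continuousAt.continuousWithinAt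
    · have hs' : s ∈ Ioo (-1 : ℝ) 1 := ⟨by linarith [hs.1], by linarith [hs.2, hr.2]⟩
      refine (((hasDerivAt_pow (k + 1) s).mul (hy2 s hs')).add (hkint s)).congr_deriv ?_
      have h1 := hode s ⟨hs.1, by linarith [hs.2, hr.2]⟩
      have hs0 := hs.1.ne'
      have h2 : g (s ^ 2 / 2) = -(deriv (deriv y) s + (k + 1) * (deriv y s / s)) := by linarith
      rw [h2, Nat.add_sub_cancel]
      push_cast
      field_simp
      ring
  intro r hr
  have hz := eq_of_hasDerivAt_zero (b := r)
    (f := fun r => y r + ∫ t in (0 : ℝ)..(r ^ 2 / 2), radAvg (k + 1) g t) hr.1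
  have hder : ∀ s ∈ Ioo (-1 : ℝ) 1, HasDerivAt
      (fun r => y r + ∫ t in (0 : ℝ)..(r ^ 2 / 2), radAvg (k + 1) g t)
      (deriv y s + radAvg (k + 1) g (s ^ 2 / 2) * s) s := by
    intro s hs
    have h1 : HasDerivAt (fun r : ℝ => r ^ 2 / 2) s s := by
      refine ((hasDerivAt_pow 2 s).div_const 2).congr_deriv ?_
      simp
    have h2 := ((continuous_radAvg (k + 1) hg).integral_hasStrictDerivAt 0 (s ^ 2 / 2)).hasDerivAt
    exact (hy1 s hs).add (HasDerivAt.comp (h := fun r : ℝ => r ^ 2 / 2)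
      (h₂ := fun u => ∫ t in (0 : ℝ)..u, radAvg (k + 1) g t) s h2 h1)
  have h := hz (fun s hs => (hder s ⟨by linarith [hs.1], by linarith [hs.2, hr.2]⟩).continuousAt.continuousWithinAt)
    fun s hs => (hder s ⟨by linarith [hs.1], by linarith [hs.2, hr.2]⟩).congr_deriv (by
      rw [hfirst s ⟨hs.1, by linarith [hs.2, hr.2]⟩]; ring)
  simp only [ne_eq, OfNat.ofNat_ne_zero, not_false_eq_true, zero_pow, zero_div,
    intervalIntegral.integral_same, add_zero, hyF r hr.1, hyF 0 le_rfl] at h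
  have : k + 2 - 1 = k + 1 := rfl
  rw [this]
  linarith

/-- The double integral `ρ ↦ a - ∫₀^ρ radAvg m g`. -/
def radPrim (m : ℕ) (a : ℝ) (g : ℝ → ℝ) (ρ : ℝ) : ℝ := a - ∫ t in (0 : ℝ)..ρ, radAvg m g t

theorem hasDerivAt_radPrim (m : ℕ) (a : ℝ) {g : ℝ → ℝ} (hg : Continuous g) (ρ : ℝ) :
    HasDerivAt (radPrim m a g) (-radAvg m g ρ) ρ :=
  (((continuous_radAvg m hg).integral_hasStrictDerivAt 0 ρ).hasDerivAt).const_sub a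

theorem contDiff_radPrim (k m : ℕ) (a : ℝ) {g : ℝ → ℝ} (hg : ContDiff ℝ k g) :
    ContDiff ℝ (k + 1) (radPrim m a g) := by
  rw [contDiff_succ_iff_deriv]
  refine ⟨fun ρ => (hasDerivAt_radPrim m a hg.continuous ρ).differentiableAt, by simp, ?_⟩
  rw [funext fun ρ => (hasDerivAt_radPrim m a hg.continuous ρ).deriv]
  exact (contDiff_radAvg k m hg).neg

theorem radPrim_congr (m : ℕ) (a : ℝ) {g₁ g₂ : ℝ → ℝ} {c : ℝ} (h : EqOn g₁ g₂ (Icc 0 c)) :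
    EqOn (radPrim m a g₁) (radPrim m a g₂) (Icc 0 c) := by
  intro ρ hρ
  unfold radPrim
  congr 1
  refine intervalIntegral.integral_congr fun t ht => ?_
  rw [uIcc_of_le hρ.1] at ht
  exact radAvg_congr m h ⟨ht.1, ht.2.trans hρ.2⟩

/-- Radial Gelfand profile in the variable `ρ = r² / 2`, in dimension `d`:
`V' = -P` and `2ρP' + dP = g`, where `g = lam e^V` on `[0, 1/2]`. -/
structure GelfandProfile (d : ℕ) (lam : ℝ) (V P g : ℝ → ℝ) : Prop where
  contDiff_V : ContDiff ℝ 2 V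
  contDiff_P : ContDiff ℝ 2 P
  P_pos : ∀ ρ, 0 < P ρ
  deriv_V : ∀ ρ, HasDerivAt V (-P ρ) ρ
  ode : ∀ ρ, 2 * ρ * deriv P ρ + d * P ρ = g ρ
  contDiff_g : ContDiff ℝ 1 g
  g_pos : ∀ ρ, 0 < g ρ
  g_eq : ∀ ρ ∈ Icc (0 : ℝ) (1 / 2), g ρ = lam * exp (V ρ)
  deriv_g : ∀ ρ ∈ Icc (0 : ℝ) (1 / 2), HasDerivAt g (-(P ρ * g ρ)) ρ

theorem exists_gelfandProfile {d : ℕ} (hd : 1 ≤ d) {lam : ℝ} (hlam : 0 < lam) {V₀ : ℝ → ℝ}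
    (hV₀ : Continuous V₀) {a : ℝ}
    (h : EqOn V₀ (radPrim (d - 1) a fun ρ => lam * exp (V₀ ρ)) (Icc 0 (1 / 2))) :
    ∃ V P g : ℝ → ℝ, GelfandProfile d lam V P g ∧ EqOn V V₀ (Icc 0 (1 / 2)) := by
  set N : (ℝ → ℝ) → ℝ → ℝ := fun v ρ => lam * exp (v ρ) with hN
  have hNc : ∀ {k : ℕ} {v : ℝ → ℝ}, ContDiff ℝ k v → ContDiff ℝ k (N v) := fun hv =>
    contDiff_const.mul hv.exp
  have hNe : ∀ {v₁ v₂ : ℝ → ℝ}, EqOn v₁ v₂ (Icc 0 (1 / 2)) →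
      EqOn (N v₁) (N v₂) (Icc 0 (1 / 2)) := fun hv ρ hρ => by simp only [hN, hv hρ]
  have hNpos : ∀ v ρ, 0 < N v ρ := fun v ρ => mul_pos hlam (exp_pos _)
  have h0 : ContDiff ℝ ((0 : ℕ) : ℕ∞ω) V₀ := by exact_mod_cast contDiff_zero.mpr hV₀
  set V₁ := radPrim (d - 1) a (N V₀)
  set V₂ := radPrim (d - 1) a (N V₁)
  set V₃ := radPrim (d - 1) a (N V₂)
  have h1 : ContDiff ℝ ((1 : ℕ) : ℕ∞ω) V₁ := by
    simpa using contDiff_radPrim 0 (d - 1) a (hNc h0)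
  have h2 : ContDiff ℝ ((2 : ℕ) : ℕ∞ω) V₂ := by
    simpa [one_add_one_eq_two] using contDiff_radPrim 1 (d - 1) a (hNc h1)
  have h3 : ContDiff ℝ ((2 : ℕ) + 1 : ℕ∞ω) V₃ := contDiff_radPrim 2 (d - 1) a (hNc h2)
  have e1 : EqOn V₀ V₁ (Icc 0 (1 / 2)) := h
  have e2 : EqOn V₁ V₂ (Icc 0 (1 / 2)) := radPrim_congr _ _ (hNe e1)
  have e3 : EqOn V₂ V₃ (Icc 0 (1 / 2)) := radPrim_congr _ _ (hNe e2)
  refine ⟨V₃, radAvg (d - 1) (N V₂), N V₂, ⟨h3.of_le (by norm_num), ?_, ?_, ?_, ?_, ?_, ?_, ?_, ?_⟩,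
    (e1.trans (e2.trans e3)).symm⟩
  · exact_mod_cast contDiff_radAvg 2 (d - 1) (hNc h2)
  · exact radAvg_pos _ (hNc h2).continuous (hNpos _)
  · exact hasDerivAt_radPrim _ _ (hNc h2).continuous
  · intro ρ
    have := radAvg_ode (d - 1) ((hNc h2).of_le (by norm_num)) ρ
    rw [Nat.cast_sub hd] at this
    simpa using this
  · exact (hNc h2).of_le (by norm_num)
  · exact hNpos _
  · intro ρ hρ
    exact hNe e3 hρ
  · intro ρ hρ
    have hd2 := ((hasDerivAt_radPrim (d - 1) a (hNc h1).continuous ρ).exp).const_mul lam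
    refine hd2.congr_deriv ?_
    rw [radAvg_congr (d - 1) (hNe e2) hρ]
    simp only [hN]
    ring

/-- The radial torsion-type profile: `w' = -Y` and `2ρY' + dY = g w + 1` on `[0, 1/2]`. -/
theorem exists_torsionProfile {d : ℕ} (hd : 1 ≤ d) {g w₀ : ℝ → ℝ} (hg : ContDiff ℝ 1 g)
    (hw₀ : Continuous w₀) {a : ℝ}
    (h : EqOn w₀ (radPrim (d - 1) a fun ρ => g ρ * w₀ ρ + 1) (Icc 0 (1 / 2))) :
    ∃ w Y Y' : ℝ → ℝ, EqOn w w₀ (Icc 0 (1 / 2)) ∧ (∀ ρ, HasDerivAt w (-Y ρ) ρ) ∧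
      (∀ ρ, HasDerivAt Y (Y' ρ) ρ) ∧
      ∀ ρ ∈ Icc (0 : ℝ) (1 / 2), 2 * ρ * Y' ρ + d * Y ρ = g ρ * w ρ + 1 := by
  have hc0 : Continuous fun ρ => g ρ * w₀ ρ + 1 := (hg.continuous.mul hw₀).add continuous_const
  have h1 : ContDiff ℝ 1 (radPrim (d - 1) a fun ρ => g ρ * w₀ ρ + 1) := by
    simpa using contDiff_radPrim 0 (d - 1) a (g := fun ρ => g ρ * w₀ ρ + 1)
      (by exact_mod_cast contDiff_zero.mpr hc0)
  set w₁ := radPrim (d - 1) a fun ρ => g ρ * w₀ ρ + 1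
  have hc1 : ContDiff ℝ 1 fun ρ => g ρ * w₁ ρ + 1 := (hg.mul h1).add contDiff_const
  have e1 : EqOn w₀ w₁ (Icc 0 (1 / 2)) := h
  have e2 : EqOn w₁ (radPrim (d - 1) a fun ρ => g ρ * w₁ ρ + 1) (Icc 0 (1 / 2)) :=
    radPrim_congr _ _ fun ρ hρ => by simp only [e1 hρ]
  refine ⟨_, _, _, (e1.trans e2).symm, hasDerivAt_radPrim _ _ hc1.continuous,
    fun ρ => (hasDerivAt_radAvg _ hc1 ρ).differentiableAt.hasDerivAt, fun ρ hρ => ?_⟩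
  have := radAvg_ode (d - 1) hc1 ρ
  rw [Nat.cast_sub hd] at this
  rw [← e2 hρ]
  simpa using this

namespace GelfandProfile

variable {d : ℕ} {lam : ℝ} {V P g : ℝ → ℝ}

theorem hasDerivAt_P (hp : GelfandProfile d lam V P g) (ρ : ℝ) :
    HasDerivAt P (deriv P ρ) ρ :=
  (hp.contDiff_P.differentiable (by norm_num) ρ).hasDerivAt

theorem hasDerivAt_deriv_P (hp : GelfandProfile d lam V P g) (ρ : ℝ) :
    HasDerivAt (deriv P) (deriv (deriv P) ρ) ρ := by
  have h : ContDiff ℝ (1 + 1) P := by simpa [one_add_one_eq_two] using hp.contDiff_P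
  exact ((contDiff_succ_iff_deriv.mp h).2.2.differentiable (by norm_num) ρ).hasDerivAt

theorem ode_deriv (hp : GelfandProfile d lam V P g) {ρ : ℝ} (hρ : ρ ∈ Icc (0 : ℝ) (1 / 2)) :
    2 * ρ * deriv (deriv P) ρ + (d + 2) * deriv P ρ = -(P ρ * g ρ) := by
  have h1 := ((((hasDerivAt_id ρ).const_mul 2).mul (hp.hasDerivAt_deriv_P ρ)).add
    ((hp.hasDerivAt_P ρ).const_mul (d : ℝ)))
  have h2 : HasDerivAt (fun ρ => 2 * ρ * deriv P ρ + d * P ρ) (-(P ρ * g ρ)) ρ := by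
    rw [funext hp.ode]
    exact hp.deriv_g ρ hρ
  have := h1.unique h2
  simp only [id] at this
  linarith

theorem bracket_pos (hp : GelfandProfile d lam V P g) (hd : 1 ≤ d) {c : ℝ} (hc : 0 < c)
    (hc' : c ≤ 1 / 2) (hζ : ∀ ρ ∈ Ioo 0 c, ρ * P ρ < 1) : 0 < P c + c * deriv P c := by
  refine singular_ode_pos hd hc (X := fun ρ => P ρ + ρ * deriv P ρ)
    (X' := fun ρ => 2 * deriv P ρ + ρ * deriv (deriv P) ρ) (g := fun ρ => g ρ * (1 - ρ * P ρ))
    (fun ρ => ?_) (fun ρ hρ => ?_) (fun ρ hρ => ?_)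
  · refine ((hp.hasDerivAt_P ρ).add
      ((hasDerivAt_id ρ).mul (hp.hasDerivAt_deriv_P ρ))).congr_deriv ?_
    simp only [id]; ring
  · have h1 := hp.ode_deriv (ρ := ρ) ⟨hρ.1.le, by linarith [hρ.2]⟩
    have h2 := hp.ode ρ
    linear_combination ρ * h1 + h2
  · exact mul_pos (hp.g_pos ρ) (by linarith [hζ ρ hρ])

/-- Stability, in the form of a nonnegative torsion function, forces `ρ P < 1`. -/
theorem mul_P_lt_one (hp : GelfandProfile d lam V P g) (hd : 1 ≤ d) {w Y Y' : ℝ → ℝ}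
    (hw : ∀ ρ, HasDerivAt w (-Y ρ) ρ) (hY : ∀ ρ, HasDerivAt Y (Y' ρ) ρ)
    (hode : ∀ ρ ∈ Icc (0 : ℝ) (1 / 2), 2 * ρ * Y' ρ + d * Y ρ = g ρ * w ρ + 1)
    (hw0 : ∀ ρ ∈ Ico (0 : ℝ) (1 / 2), 0 ≤ w ρ) : ∀ ρ ∈ Ico (0 : ℝ) (1 / 2), ρ * P ρ < 1 := by
  by_contra! hcon
  obtain ⟨ρ₁, hρ₁, hρ₁'⟩ := hcon
  have hPc : Continuous P := hp.contDiff_P.continuous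
  have hcomp : IsCompact {ρ ∈ Icc 0 ρ₁ | 1 ≤ ρ * P ρ} :=
    isCompact_Icc.inter_right
      (isClosed_le continuous_const (continuous_id.mul hPc))
  obtain ⟨c, ⟨hcm, hc1⟩, hleast⟩ := hcomp.exists_isLeast ⟨ρ₁, right_mem_Icc.mpr hρ₁.1, hρ₁'⟩
  have hlt : ∀ ρ ∈ Ioo 0 c, ρ * P ρ < 1 := by
    intro ρ hρ
    by_contra! h
    exact absurd (hleast ⟨⟨hρ.1.le, by linarith [hρ.2, hcm.2]⟩, h⟩) (not_le.mpr hρ.2)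
  have hc : 0 < c := by
    rcases hcm.1.eq_or_lt with h | h
    · rw [← h] at hc1; norm_num at hc1
    · exact h
  have hc2 : c < 1 / 2 := by linarith [hcm.2, hρ₁.2]
  have hB := hp.bracket_pos hd hc hc2.le hlt
  have hX := singular_ode_pos hd hc
    (X := fun ρ => (1 - ρ * P ρ) * Y ρ - (P ρ + ρ * deriv P ρ) * w ρ)
    (X' := fun ρ => (1 - ρ * P ρ) * Y' ρ - (2 * deriv P ρ + ρ * deriv (deriv P) ρ) * w ρ)
    (g := fun ρ => 1 - ρ * P ρ) (fun ρ => ?_) (fun ρ hρ => ?_)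
    (fun ρ hρ => by linarith [hlt ρ hρ])
  · have := mul_nonneg hB.le (hw0 c ⟨hc.le, hc2⟩)
    have hYc : (1 - c * P c) * Y c ≤ 0 := by
      have hle : c * P c ≤ 1 := by
        refine le_of_tendsto (f := fun ρ => ρ * P ρ) (x := 𝓝[<] c)
          ((by fun_prop : Continuous fun ρ => ρ * P ρ).continuousAt.tendsto.mono_left
            nhdsWithin_le_nhds) ?_
        filter_upwards [Ioo_mem_nhdsLT hc] with ρ hρ using (hlt ρ hρ).le
      rw [show 1 - c * P c = 0 by linarith, zero_mul]
    linarith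
  · have h1 : HasDerivAt (fun ρ => 1 - ρ * P ρ) (-(P ρ + ρ * deriv P ρ)) ρ := by
      refine (((hasDerivAt_id ρ).mul (hp.hasDerivAt_P ρ)).const_sub 1).congr_deriv ?_
      simp only [id]; ring
    have h2 : HasDerivAt (fun ρ => P ρ + ρ * deriv P ρ)
        (2 * deriv P ρ + ρ * deriv (deriv P) ρ) ρ := by
      refine ((hp.hasDerivAt_P ρ).add
        ((hasDerivAt_id ρ).mul (hp.hasDerivAt_deriv_P ρ))).congr_deriv ?_
      simp only [id]; ring
    refine ((h1.mul (hY ρ)).sub (h2.mul (hw ρ))).congr_deriv ?_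
    ring
  · have hm : ρ ∈ Icc (0 : ℝ) (1 / 2) := ⟨hρ.1.le, by linarith [hρ.2]⟩
    have h1 := hp.ode_deriv hm
    have h2 := hp.ode ρ
    have h3 := hode ρ hm
    linear_combination (1 - ρ * P ρ) * h3 - w ρ * ρ * h1 - w ρ * h2

theorem two_mul_g_ge (hp : GelfandProfile d lam V P g) (hd : 2 ≤ d)
    (hP : ∀ ρ ∈ Ico (0 : ℝ) (1 / 2), ρ * P ρ < 1) {c : ℝ} (hc : c ∈ Ioo (0 : ℝ) (1 / 2)) :
    (d - 1) * P c ≤ 2 * g c := by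
  have hc' := hP c ⟨hc.1.le, hc.2⟩
  have hPc := hp.P_pos c
  rcases hd.eq_or_lt with h2 | h3
  · subst h2
    have hR := singular_ode_nonneg (d := 2) (by norm_num) hc.1
      (X := fun ρ => 2 * ρ * deriv P ρ + ρ * P ρ ^ 2)
      (X' := fun ρ => 2 * deriv P ρ + 2 * ρ * deriv (deriv P) ρ + P ρ ^ 2
        + 2 * ρ * P ρ * deriv P ρ)
      (g := fun _ => 0) (fun ρ => ?_) (fun ρ hρ => ?_) (fun _ _ => le_rfl)
    · have h1 := hp.ode c
      push_cast at h1 ⊢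
      nlinarith
    · refine ((((hasDerivAt_id ρ).const_mul 2).mul (hp.hasDerivAt_deriv_P ρ)).add
        ((hasDerivAt_id ρ).mul ((hp.hasDerivAt_P ρ).pow 2))).congr_deriv ?_
      simp only [id, Pi.pow_apply]
      push_cast
      ring
    · have hm : ρ ∈ Icc (0 : ℝ) (1 / 2) := ⟨hρ.1.le, by linarith [hρ.2, hc.2]⟩
      have h1 := hp.ode_deriv hm
      have h2 := hp.ode ρ
      push_cast at h1 h2 ⊢
      linear_combination 2 * ρ * h1 + 2 * ρ * P ρ * h2
  · have hB := hp.bracket_pos (by omega) hc.1 hc.2.le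
      fun ρ hρ => hP ρ ⟨hρ.1.le, hρ.2.trans hc.2⟩
    have h1 := hp.ode c
    have h3' : (3 : ℝ) ≤ d := by exact_mod_cast h3
    nlinarith [mul_nonneg (sub_nonneg.mpr h3') hPc.le]

/-- The corrector `G = P h` of the first angular mode; stability gives `0 ≤ h ≤ 1/2`. -/
theorem exists_corrector (hp : GelfandProfile d lam V P g) (hd : 2 ≤ d)
    (hP : ∀ ρ ∈ Ico (0 : ℝ) (1 / 2), ρ * P ρ < 1) :
    ∃ h G' G'' : ℝ → ℝ, ContDiff ℝ 2 h ∧ h (1 / 2) = 0 ∧ (∀ ρ ∈ Icc (0 : ℝ) (1 / 2), |h ρ| ≤ 1 / 2) ∧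
      Continuous G' ∧ (∀ ρ, HasDerivAt (fun ρ => P ρ * h ρ) (G' ρ) ρ) ∧
      (∀ ρ, HasDerivAt G' (G'' ρ) ρ) ∧
      ∀ ρ ∈ Icc (0 : ℝ) (1 / 2),
        2 * ρ * G'' ρ + (d + 2) * G' ρ + g ρ * (P ρ * h ρ) = -P ρ := by
  have hP2 : ContDiff ℝ 2 fun ρ => P ρ ^ 2 := hp.contDiff_P.pow 2
  have hP21 : ContDiff ℝ 1 fun ρ => P ρ ^ 2 := hP2.of_le (by norm_num)
  set Q := radAvg (d + 1) fun ρ => P ρ ^ 2 with hQdef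
  have hQ2 : ContDiff ℝ 2 Q := contDiff_radAvg 2 (d + 1) hP2
  have hQd : ∀ ρ, HasDerivAt Q (deriv Q ρ) ρ := fun ρ =>
    (hQ2.differentiable (by norm_num) ρ).hasDerivAt
  have hQode : ∀ ρ, 2 * ρ * deriv Q ρ + (d + 2) * Q ρ = P ρ ^ 2 := fun ρ => by
    have := radAvg_ode (d + 1) hP21 ρ
    push_cast at this
    linarith
  have hQpos : ∀ ρ, 0 < Q ρ :=
    radAvg_pos _ hP2.continuous fun ρ => pow_pos (hp.P_pos ρ) 2
  have hd2 : (2 : ℝ) ≤ d := by exact_mod_cast hd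
  have hQle : ∀ c ∈ Icc (0 : ℝ) (1 / 2), Q c ≤ P c ^ 2 := by
    intro c hc
    rcases hc.1.eq_or_lt with h0 | h0
    · have := hQode c
      rw [← h0] at this ⊢
      have := hQpos 0
      nlinarith
    · have := singular_ode_nonneg (d := d + 2) (by omega) h0 (X := fun ρ => P ρ ^ 2 - Q ρ)
        (X' := fun ρ => 2 * P ρ * deriv P ρ - deriv Q ρ)
        (g := fun ρ => P ρ * (2 * g ρ - (d - 1) * P ρ)) (fun ρ => ?_) (fun ρ hρ => ?_)
        (fun ρ hρ => ?_)
      · linarith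
      · refine (((hp.hasDerivAt_P ρ).pow 2).sub (hQd ρ)).congr_deriv ?_
        push_cast
        ring
      · have h1 := hQode ρ
        have h2 := hp.ode ρ
        push_cast
        linear_combination 2 * P ρ * h2 - h1
      · exact mul_nonneg (hp.P_pos ρ).le
          (by linarith [hp.two_mul_g_ge hd hP ⟨hρ.1, by linarith [hρ.2, hc.2]⟩])
  have hP0 : ∀ ρ, P ρ ≠ 0 := fun ρ => (hp.P_pos ρ).ne'
  set q : ℝ → ℝ := fun ρ => Q ρ / P ρ ^ 2 with hq
  have hqc : ContDiff ℝ 2 q := hQ2.div hP2 fun ρ => pow_ne_zero 2 (hP0 ρ)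
  set h : ℝ → ℝ := fun ρ => -∫ t in (1 / 2 : ℝ)..ρ, q t with hh
  have hhd : ∀ ρ, HasDerivAt h (-q ρ) ρ := fun ρ =>
    ((hqc.continuous.integral_hasStrictDerivAt (1 / 2) ρ).hasDerivAt).neg
  have hhc : ContDiff ℝ (1 + 1) h := by
    rw [contDiff_succ_iff_deriv]
    refine ⟨fun ρ => (hhd ρ).differentiableAt, by simp, ?_⟩
    rw [funext fun ρ => (hhd ρ).deriv]
    exact (hqc.of_le (by norm_num)).neg
  have hP1c : Continuous (deriv P) := hp.contDiff_P.continuous_deriv (by norm_num)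
  refine ⟨h, fun ρ => deriv P ρ * h ρ - Q ρ / P ρ,
    fun ρ => deriv (deriv P) ρ * h ρ - deriv Q ρ / P ρ,
    by simpa [one_add_one_eq_two] using hhc, by simp [hh], fun ρ hρ => ?_, ?_, fun ρ => ?_,
    fun ρ => ?_, fun ρ hρ => ?_⟩
  · have := intervalIntegral.norm_integral_le_of_norm_le_const (a := 1 / 2) (b := ρ) (f := q)
      (C := 1) fun t ht => ?_
    · simp only [hh, abs_neg]
      rw [Real.norm_eq_abs, one_mul] at this
      refine this.trans ?_
      rw [abs_le]
      constructor <;> linarith [hρ.1, hρ.2]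
    · rw [uIoc_of_ge hρ.2] at ht
      have hm : t ∈ Icc (0 : ℝ) (1 / 2) := ⟨by linarith [hρ.1, ht.1], ht.2⟩
      have hpp : 0 < P t ^ 2 := pow_pos (hp.P_pos t) 2
      rw [Real.norm_of_nonneg (div_nonneg (hQpos t).le hpp.le), div_le_one hpp]
      exact hQle t hm
  · exact (hP1c.mul hhc.continuous).sub (hQ2.continuous.div hp.contDiff_P.continuous hP0)
  · refine ((hp.hasDerivAt_P ρ).mul (hhd ρ)).congr_deriv ?_
    have := hP0 ρ
    simp only [hq]
    field_simp
    ring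
  · refine (((hp.hasDerivAt_deriv_P ρ).mul (hhd ρ)).sub
      ((hQd ρ).div (hp.hasDerivAt_P ρ) (hP0 ρ))).congr_deriv ?_
    have := hP0 ρ
    simp only [hq]
    field_simp
    ring
  · have h1 := hp.ode_deriv hρ
    have h2 := hQode ρ
    have h3 := hP0 ρ
    have h4 : (2 * ρ * deriv Q ρ + (d + 2) * Q ρ) / P ρ = P ρ := by
      rw [h2]; field_simp
    rw [add_div] at h4
    linear_combination h ρ * h1 - h4

end GelfandProfile

/-- A smooth embedded closed curve, parametrised by a regular `1`-periodic map. -/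
structure IsEmbeddedLoop {n : ℕ} (γ : ℝ → EuclideanSpace ℝ (Fin n)) : Prop where
  smooth : ContDiff ℝ ∞ γ
  periodic : Function.Periodic γ 1
  regular : ∀ t, deriv γ t ≠ 0
  inj : ∀ s t, γ s = γ t → ∃ k : ℤ, s - t = k

theorem exists_le_of_periodic {f : ℝ → ℝ} (hf : Continuous f) (hp : Function.Periodic f 1)
    (hpos : ∀ t, 0 < f t) : ∃ a > 0, ∀ t, a ≤ f t := by
  obtain ⟨a, ha, h⟩ := isCompact_Icc (a := (0 : ℝ)) (b := 1).exists_forall_le'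
    hf.continuousOn (a := 0) fun b _ => hpos b
  refine ⟨a, ha, fun t => ?_⟩
  have h1 : f (Int.fract t) = f t := by
    rw [Int.fract]; simpa using hp.sub_int_mul_eq ⌊t⌋ (x := t)
  rw [← h1]
  exact h _ ⟨Int.fract_nonneg t, (Int.fract_lt_one t).le⟩

theorem exists_norm_le_of_periodic {F : Type*} [NormedAddCommGroup F] {f : ℝ → F}
    (hf : Continuous f) (hp : Function.Periodic f 1) : ∃ A > 0, ∀ t, ‖f t‖ ≤ A := by
  obtain ⟨A, h⟩ := isCompact_Icc (a := (0 : ℝ)) (b := 1).exists_bound_of_continuousOn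
    hf.continuousOn
  refine ⟨|A| + 1, by positivity, fun t => ?_⟩
  have h1 : f (Int.fract t) = f t := by
    rw [Int.fract]; simpa using hp.sub_int_mul_eq ⌊t⌋ (x := t)
  rw [← h1]
  have := h _ ⟨Int.fract_nonneg t, (Int.fract_lt_one t).le⟩
  have := le_abs_self A
  linarith

theorem Function.Periodic.deriv_one {F : Type*} [NormedAddCommGroup F] [NormedSpace ℝ F]
    {f : ℝ → F} (hp : Function.Periodic f 1) : Function.Periodic (deriv f) 1 := fun t => by
  rw [← deriv_comp_add_const]
  congr 1
  funext s
  exact hp s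

namespace IsEmbeddedLoop

variable {n : ℕ} {γ : ℝ → EuclideanSpace ℝ (Fin n)}

theorem contDiff_deriv (h : IsEmbeddedLoop γ) : ContDiff ℝ ∞ (deriv γ) :=
  (contDiff_infty_iff_deriv.1 h.smooth).2

theorem contDiff_deriv2 (h : IsEmbeddedLoop γ) : ContDiff ℝ ∞ (deriv (deriv γ)) :=
  (contDiff_infty_iff_deriv.1 h.contDiff_deriv).2

theorem hasDerivAt (h : IsEmbeddedLoop γ) (t : ℝ) : HasDerivAt γ (deriv γ t) t :=
  (h.smooth.differentiable (by simp) t).hasDerivAt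

theorem hasDerivAt_deriv (h : IsEmbeddedLoop γ) (t : ℝ) :
    HasDerivAt (deriv γ) (deriv (deriv γ) t) t :=
  (h.contDiff_deriv.differentiable (by simp) t).hasDerivAt

theorem apply_sub_int (h : IsEmbeddedLoop γ) (t : ℝ) (k : ℤ) : γ (t - k) = γ t := by
  simpa using h.periodic.sub_int_mul_eq k (x := t)

theorem exists_int_near (h : IsEmbeddedLoop γ) {η : ℝ} (hη : 0 < η) :
    ∃ δ > 0, ∀ s t, ‖γ s - γ t‖ < δ → ∃ k : ℤ, |s - t - k| < η := by
  have hK : IsCompact ((Icc (0 : ℝ) 1 ×ˢ Icc (0 : ℝ) 1) ∩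
      {p : ℝ × ℝ | ∀ k : ℤ, η ≤ |p.1 - p.2 - k|}) := by
    refine (isCompact_Icc.prod isCompact_Icc).inter_right ?_
    simp only [ofPred_forall]
    exact isClosed_iInter fun k => isClosed_le continuous_const (by fun_prop)
  have hc := h.smooth.continuous
  obtain ⟨δ, hδ, hmin⟩ := hK.exists_forall_le' (f := fun p : ℝ × ℝ => ‖γ p.1 - γ p.2‖) (a := 0)
    (by fun_prop) (by
      rintro ⟨s, t⟩ ⟨-, hst⟩
      refine norm_pos_iff.2 fun h0 => ?_
      obtain ⟨k, hk⟩ := h.inj s t (sub_eq_zero.1 h0)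
      have := hst k
      simp only at this
      rw [hk, sub_self, abs_zero] at this
      linarith)
  refine ⟨δ, hδ, fun s t hst => ?_⟩
  by_contra! hcon
  have := hmin (Int.fract s, Int.fract t) ⟨⟨⟨Int.fract_nonneg s, (Int.fract_lt_one s).le⟩,
    ⟨Int.fract_nonneg t, (Int.fract_lt_one t).le⟩⟩, fun k => by
      have := hcon (k + ⌊s⌋ - ⌊t⌋)
      push_cast at this
      refine this.trans_eq (congrArg abs ?_)
      simp only [Int.fract]
      ring⟩
  simp only [Int.fract, h.apply_sub_int] at this
  linarith

theorem hasDerivAt_inner (h : IsEmbeddedLoop γ) (x : EuclideanSpace ℝ (Fin n)) (t : ℝ) :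
    HasDerivAt (fun s => inner ℝ (x - γ s) (deriv γ s))
      (inner ℝ (x - γ t) (deriv (deriv γ) t) - ‖deriv γ t‖ ^ 2) t := by
  have := ((h.hasDerivAt t).const_sub x).inner ℝ (h.hasDerivAt_deriv t)
  refine this.congr_deriv ?_
  rw [inner_neg_left, real_inner_self_eq_norm_sq]
  ring

/-- Quantitative data of a tubular neighbourhood: `a` bounds the squared speed from below, `A` the
acceleration from above, and a point has at most one foot point within distance `δ`. -/
theorem exists_tubular_radius (h : IsEmbeddedLoop γ) :
    ∃ a A δ : ℝ, 0 < a ∧ 0 < A ∧ 0 < δ ∧ 2 * (δ * A) ≤ a ∧ (∀ t, a ≤ ‖deriv γ t‖ ^ 2) ∧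
      (∀ t, ‖deriv (deriv γ) t‖ ≤ A) ∧
      ∀ x s t, ‖x - γ s‖ < δ → ‖x - γ t‖ < δ → inner ℝ (x - γ s) (deriv γ s) = 0 →
        inner ℝ (x - γ t) (deriv γ t) = 0 → ∃ k : ℤ, s - t = k := by
  have hp1 := h.periodic.deriv_one
  obtain ⟨a, ha, ha'⟩ := exists_le_of_periodic (f := fun t => ‖deriv γ t‖ ^ 2)
    (h.contDiff_deriv.continuous.norm.pow 2) (fun t => by simp only [hp1 t])
    fun t => by have := norm_pos_iff.2 (h.regular t); positivity
  obtain ⟨A, hA, hA'⟩ := exists_norm_le_of_periodic h.contDiff_deriv2.continuous hp1.deriv_one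
  obtain ⟨B, hB, hB'⟩ := exists_norm_le_of_periodic h.contDiff_deriv.continuous hp1
  have hlip : ∀ s t, ‖γ s - γ t‖ ≤ B * |s - t| := fun s t =>
    convex_univ.norm_image_sub_le_of_norm_hasDerivWithin_le
      (fun x _ => (h.hasDerivAt x).hasDerivWithinAt) (fun x _ => hB' x) (mem_univ t) (mem_univ s)
  set δ₀ := a / (4 * A) with hδ₀
  have hδ₀pos : 0 < δ₀ := by positivity
  have hδ₀A : δ₀ * A = a / 4 := by rw [hδ₀]; field_simp
  obtain ⟨δ₁, hδ₁, hsep⟩ := h.exists_int_near (η := δ₀ / B) (by positivity)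
  refine ⟨a, A, min δ₀ (δ₁ / 2), ha, hA, by positivity, ?_, ha', hA', ?_⟩
  · have : min δ₀ (δ₁ / 2) * A ≤ δ₀ * A := by gcongr; exact min_le_left _ _
    linarith
  intro x s t hs ht hFs hFt
  obtain ⟨k, hk⟩ := hsep s t (by
    have h1 : ‖γ s - γ t‖ ≤ ‖x - γ t‖ + ‖x - γ s‖ := by
      rw [show γ s - γ t = (x - γ t) - (x - γ s) by abel]; exact norm_sub_le _ _
    have := min_le_right δ₀ (δ₁ / 2)
    linarith)
  refine ⟨k, ?_⟩
  have hFs' : inner ℝ (x - γ (s - k)) (deriv γ (s - k)) = 0 := by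
    have : deriv γ (s - k) = deriv γ s := by simpa using hp1.sub_int_mul_eq k (x := s)
    rw [h.apply_sub_int, this, hFs]
  have hneg : ∀ u, |u - t| < δ₀ / B →
      inner ℝ (x - γ u) (deriv (deriv γ) u) - ‖deriv γ u‖ ^ 2 ≠ 0 := by
    intro u hu
    have h1 : ‖x - γ u‖ ≤ 2 * δ₀ := by
      have h2 : ‖x - γ u‖ ≤ ‖x - γ t‖ + ‖γ u - γ t‖ := by
        rw [show x - γ u = (x - γ t) - (γ u - γ t) by abel]; exact norm_sub_le _ _
      have h3 := hlip u t
      have h4 : B * |u - t| ≤ δ₀ := by rw [lt_div_iff₀ hB] at hu; linarith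
      have := min_le_left δ₀ (δ₁ / 2)
      linarith
    have h2 : inner ℝ (x - γ u) (deriv (deriv γ) u) ≤ 2 * δ₀ * A :=
      (real_inner_le_norm _ _).trans (mul_le_mul h1 (hA' u) (norm_nonneg _) (by positivity))
    have := ha' u
    linarith
  have hcont : Continuous fun u => inner ℝ (x - γ u) (deriv γ u) :=
    (continuous_const.sub h.smooth.continuous).inner h.contDiff_deriv.continuous
  rw [abs_lt] at hk
  rcases lt_trichotomy (s - k) t with hlt | heq | hlt
  · obtain ⟨c, hc, hc'⟩ := exists_hasDerivAt_eq_zero hlt hcont.continuousOn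
      (hFs'.trans hFt.symm) fun u _ => h.hasDerivAt_inner x u
    exact absurd hc' (hneg c (by rw [abs_lt]; constructor <;> linarith [hc.1, hc.2]))
  · linarith
  · obtain ⟨c, hc, hc'⟩ := exists_hasDerivAt_eq_zero hlt hcont.continuousOn
      (hFt.trans hFs'.symm) fun u _ => h.hasDerivAt_inner x u
    exact absurd hc' (hneg c (by rw [abs_lt]; constructor <;> linarith [hc.1, hc.2]))

theorem exists_foot (h : IsEmbeddedLoop γ) (x : EuclideanSpace ℝ (Fin n)) :
    ∃ t, infDist x (range γ) = ‖x - γ t‖ ∧ inner ℝ (x - γ t) (deriv γ t) = 0 := by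
  have hcomp : IsCompact (range γ) := h.periodic.compact_of_continuous one_ne_zero
    h.smooth.continuous
  obtain ⟨_, ⟨t, rfl⟩, ht⟩ := hcomp.exists_infDist_eq_dist (range_nonempty γ) x
  rw [dist_eq_norm] at ht
  refine ⟨t, ht, ?_⟩
  have hmin : IsLocalMin (fun s => inner ℝ (x - γ s) (x - γ s)) t := by
    refine Eventually.of_forall fun s => ?_
    simp only [real_inner_self_eq_norm_sq]
    gcongr
    rw [← ht, ← dist_eq_norm]
    exact infDist_le_dist_of_mem (mem_range_self s)
  have hd := (h.hasDerivAt t).const_sub x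
  have := hmin.hasDerivAt_eq_zero (hd.inner ℝ hd)
  rw [inner_neg_left, inner_neg_right] at this
  have := real_inner_comm (x - γ t) (deriv γ t)
  linarith

theorem exists_local_foot (h : IsEmbeddedLoop γ) {x₀ : EuclideanSpace ℝ (Fin n)} {t₀ : ℝ}
    (hF : inner ℝ (x₀ - γ t₀) (deriv γ t₀) = 0)
    (hne : inner ℝ (x₀ - γ t₀) (deriv (deriv γ) t₀) - ‖deriv γ t₀‖ ^ 2 ≠ 0) :
    ∃ τ : EuclideanSpace ℝ (Fin n) → ℝ, τ x₀ = t₀ ∧ ContDiffAt ℝ 2 τ x₀ ∧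
      ∀ᶠ x in 𝓝 x₀, inner ℝ (x - γ (τ x)) (deriv γ (τ x)) = 0 := by
  set F : EuclideanSpace ℝ (Fin n) × ℝ → ℝ := fun p => inner ℝ (p.1 - γ p.2) (deriv γ p.2) with hFdef
  have cdf : ContDiffAt ℝ 2 F (x₀, t₀) := by
    have h1 : ContDiff ℝ 2 γ := contDiff_infty.1 h.smooth 2
    have h2 : ContDiff ℝ 2 (deriv γ) := contDiff_infty.1 h.contDiff_deriv 2
    exact ((contDiff_fst.sub (h1.comp contDiff_snd)).inner ℝ (h2.comp contDiff_snd)).contDiffAt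
  have hinv : (fderiv ℝ F (x₀, t₀) ∘L .inr ℝ (EuclideanSpace ℝ (Fin n)) ℝ).IsInvertible := by
    refine ⟨ContinuousLinearEquiv.unitsEquivAut ℝ (Units.mk0 _ hne), ?_⟩
    ext
    have h1 := (cdf.differentiableAt (by norm_num)).hasFDerivAt.comp_hasDerivAt t₀
      ((hasDerivAt_const t₀ x₀).prodMk (hasDerivAt_id t₀))
    have h2 := h1.unique (h.hasDerivAt_inner x₀ t₀)
    simp [h2]
  refine ⟨cdf.implicitFunction two_ne_zero hinv, cdf.implicitFunction_apply_self _ hinv,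
    cdf.contDiffAt_implicitFunction _ hinv, ?_⟩
  filter_upwards [cdf.eventually_apply_implicitFunction two_ne_zero hinv] with x hx
  simp only [hFdef] at hx
  rw [hx, hF]

end IsEmbeddedLoop

theorem HasDerivAt.comp_hasFDerivAt_smulRight {E F : Type*} [NormedAddCommGroup E]
    [NormedSpace ℝ E] [NormedAddCommGroup F] [NormedSpace ℝ F] {f : ℝ → F} {f' : F} {τ : E → ℝ}
    {L : E →L[ℝ] ℝ} {x : E} (hf : HasDerivAt f f' (τ x)) (hτ : HasFDerivAt τ L x) :
    HasFDerivAt (fun y => f (τ y)) (L.smulRight f') x :=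
  (hf.hasFDerivAt.comp x hτ).congr_fderiv (by ext v; simp)

namespace IsEmbeddedLoop

variable {n : ℕ} {γ : ℝ → EuclideanSpace ℝ (Fin n)}

theorem hasFDerivAt_sub_foot (h : IsEmbeddedLoop γ) {x : EuclideanSpace ℝ (Fin n)}
    {τ : EuclideanSpace ℝ (Fin n) → ℝ} (hτ : ContDiffAt ℝ 2 τ x) :
    HasFDerivAt (fun y => y - γ (τ y))
      (ContinuousLinearMap.id ℝ _ - (fderiv ℝ τ x).smulRight (deriv γ (τ x))) x :=
  (hasFDerivAt_id x).sub
    ((h.hasDerivAt (τ x)).comp_hasFDerivAt_smulRight (hτ.differentiableAt (by norm_num)).hasFDerivAt)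

theorem fderiv_foot (h : IsEmbeddedLoop γ) {x : EuclideanSpace ℝ (Fin n)}
    {τ : EuclideanSpace ℝ (Fin n) → ℝ} (hτ : ContDiffAt ℝ 2 τ x)
    (hF : ∀ᶠ y in 𝓝 x, inner ℝ (y - γ (τ y)) (deriv γ (τ y)) = 0)
    (v : EuclideanSpace ℝ (Fin n)) :
    fderiv ℝ τ x v * (‖deriv γ (τ x)‖ ^ 2 - inner ℝ (x - γ (τ x)) (deriv (deriv γ) (τ x))) =
      inner ℝ v (deriv γ (τ x)) := by
  have h1 := (h.hasFDerivAt_sub_foot hτ).inner ℝ ((h.hasDerivAt_deriv (τ x)).comp_hasFDerivAt_smulRight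
    (hτ.differentiableAt (by norm_num)).hasFDerivAt)
  have h2 : HasFDerivAt (fun y => inner ℝ (y - γ (τ y)) (deriv γ (τ y)))
      (0 : EuclideanSpace ℝ (Fin n) →L[ℝ] ℝ) x :=
    (hasFDerivAt_const (0 : ℝ) x).congr_of_eventuallyEq hF
  have h3 := congrArg (fun L => L v) (h1.unique h2)
  simp [fderivInnerCLM_apply, inner_sub_left, inner_smul_left, inner_smul_right] at h3
  rw [inner_sub_left]
  linarith

theorem hasFDerivAt_half_sq_foot (h : IsEmbeddedLoop γ) {x : EuclideanSpace ℝ (Fin n)}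
    {τ : EuclideanSpace ℝ (Fin n) → ℝ} (hτ : ContDiffAt ℝ 2 τ x)
    (hF : inner ℝ (x - γ (τ x)) (deriv γ (τ x)) = 0) :
    HasFDerivAt (fun y => ‖y - γ (τ y)‖ ^ 2 / 2) (innerSL ℝ (x - γ (τ x))) x := by
  have h0 := h.hasFDerivAt_sub_foot hτ
  have h1 := (h0.inner ℝ h0).mul_const (1 / 2 : ℝ)
  have : (fun y => ‖y - γ (τ y)‖ ^ 2 / 2) =
      fun y => inner ℝ (y - γ (τ y)) (y - γ (τ y)) * (1 / 2 : ℝ) := by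
    funext y
    rw [real_inner_self_eq_norm_sq]
    ring
  rw [this]
  refine h1.congr_fderiv ?_
  ext v
  have e1 := real_inner_comm (x - γ (τ x)) (deriv γ (τ x))
  rw [hF] at e1
  have e2 := real_inner_comm (x - γ (τ x)) v
  set z := x - γ (τ x)
  simp only [smul_apply, ContinuousLinearMap.comp_apply,
    ContinuousLinearMap.prod_apply, fderivInnerCLM_apply, sub_apply,
    ContinuousLinearMap.id_apply, ContinuousLinearMap.smulRight_apply, inner_sub_right,
    inner_sub_left, inner_smul_right, inner_smul_left, smul_eq_mul, innerSL_apply_apply, hF, e1, e2,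
    mul_zero, sub_zero]
  ring

/-- The curvature term `⟪x - γ(τ), γ''(τ)⟫ / ‖γ'(τ)‖²` of the foot point `τ` of `x`. -/
def footCurv (γ : ℝ → EuclideanSpace ℝ (Fin n)) (t : ℝ) (x : EuclideanSpace ℝ (Fin n)) : ℝ :=
  inner ℝ (x - γ t) ((‖deriv γ t‖ ^ 2)⁻¹ • deriv (deriv γ) t)

theorem footCurv_eq (x : EuclideanSpace ℝ (Fin n)) (t : ℝ) :
    footCurv γ t x = inner ℝ (x - γ t) (deriv (deriv γ) t) / ‖deriv γ t‖ ^ 2 := by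
  rw [footCurv, inner_smul_right]
  ring

theorem contDiff_curvVec (h : IsEmbeddedLoop γ) :
    ContDiff ℝ 2 fun t => (‖deriv γ t‖ ^ 2)⁻¹ • deriv (deriv γ) t := by
  refine ContDiff.smul (((contDiff_infty.1 h.contDiff_deriv 2).norm_sq ℝ).inv fun t => ?_)
    (contDiff_infty.1 h.contDiff_deriv2 2)
  · have := norm_pos_iff.2 (h.regular t)
    positivity

theorem local_geometry (h : IsEmbeddedLoop γ) {x : EuclideanSpace ℝ (Fin n)}
    {τ : EuclideanSpace ℝ (Fin n) → ℝ} (hτ : ContDiffAt ℝ 2 τ x)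
    (hF : ∀ᶠ y in 𝓝 x, inner ℝ (y - γ (τ y)) (deriv γ (τ y)) = 0)
    (hm : footCurv γ (τ x) x ≠ 1) :
    ContDiffAt ℝ 2 (fun y => ‖y - γ (τ y)‖ ^ 2 / 2) x ∧
    ContDiffAt ℝ 2 (fun y => footCurv γ (τ y) y) x ∧
    (∑ i, fderiv ℝ (fun y => ‖y - γ (τ y)‖ ^ 2 / 2) x (EuclideanSpace.single i 1) ^ 2 =
      ‖x - γ (τ x)‖ ^ 2) ∧
    (∑ i, fderiv ℝ (fun y => ‖y - γ (τ y)‖ ^ 2 / 2) x (EuclideanSpace.single i 1) *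
      fderiv ℝ (fun y => footCurv γ (τ y) y) x (EuclideanSpace.single i 1) =
        footCurv γ (τ x) x) ∧
    lap (fun y => ‖y - γ (τ y)‖ ^ 2 / 2) x = n - 1 / (1 - footCurv γ (τ x) x) := by
  have hz := h.hasFDerivAt_sub_foot hτ
  have hzC : ContDiffAt ℝ 2 (fun y => y - γ (τ y)) x :=
    contDiffAt_id.sub ((contDiff_infty.1 h.smooth 2).contDiffAt.comp x hτ)
  have hKC := h.contDiff_curvVec
  have hD := h.hasFDerivAt_half_sq_foot hτ hF.self_of_nhds
  have hg : 0 < ‖deriv γ (τ x)‖ ^ 2 := by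
    have := norm_pos_iff.2 (h.regular (τ x))
    positivity
  have hden : ‖deriv γ (τ x)‖ ^ 2 - inner ℝ (x - γ (τ x)) (deriv (deriv γ) (τ x)) =
      ‖deriv γ (τ x)‖ ^ 2 * (1 - footCurv γ (τ x) x) := by
    rw [footCurv_eq, mul_sub, mul_one, mul_div_cancel₀ _ hg.ne']
  have hm' : 1 - footCurv γ (τ x) x ≠ 0 := sub_ne_zero.2 hm.symm
  have hden0 : ‖deriv γ (τ x)‖ ^ 2 * (1 - footCurv γ (τ x) x) ≠ 0 := mul_ne_zero hg.ne' hm'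
  have hτ1 := h.fderiv_foot hτ hF
  refine ⟨(hzC.norm_sq ℝ).div_const 2, hzC.inner ℝ (hKC.contDiffAt.comp x hτ), ?_, ?_, ?_⟩
  · rw [hD.fderiv, ← real_inner_self_eq_norm_sq, ← innerSL_apply_apply ℝ,
      ← sum_inner_single_mul (x - γ (τ x)) (innerSL ℝ (x - γ (τ x)))]
    exact Finset.sum_congr rfl fun i _ => by rw [innerSL_apply_apply, sq]
  · rw [hD.fderiv]
    simp only [innerSL_apply_apply]
    rw [sum_inner_single_mul]
    have hdm := hz.inner ℝ (((hKC.differentiable (by norm_num) (τ x)).hasDerivAt).comp_hasFDerivAt_smulRight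
      (hτ.differentiableAt (by norm_num)).hasFDerivAt)
    have h0 : fderiv ℝ τ x (x - γ (τ x)) = 0 := by
      have := hτ1 (x - γ (τ x))
      rw [hF.self_of_nhds, hden] at this
      exact (mul_eq_zero.1 this).resolve_right hden0
    have h1 : HasFDerivAt (fun y => footCurv γ (τ y) y) _ x := hdm
    rw [h1.fderiv]
    simp only [ContinuousLinearMap.comp_apply, ContinuousLinearMap.prod_apply,
      fderivInnerCLM_apply, sub_apply, ContinuousLinearMap.id_apply,
      ContinuousLinearMap.smulRight_apply, h0, zero_smul,
      inner_zero_right, sub_zero, zero_add]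
    rfl
  · rw [lap_of_hasFDerivAt (A := fun y => innerSL ℝ (y - γ (τ y)))
      (A' := (innerSL ℝ).comp
        (ContinuousLinearMap.id ℝ _ - (fderiv ℝ τ x).smulRight (deriv γ (τ x)))) ?_
      ((innerSL ℝ).hasFDerivAt.comp x hz)]
    · have h1 : fderiv ℝ τ x (deriv γ (τ x)) = 1 / (1 - footCurv γ (τ x) x) := by
        have := hτ1 (deriv γ (τ x))
        rw [hden, real_inner_self_eq_norm_sq] at this
        field_simp
        apply mul_left_cancel₀ hg.ne'
        linarith
      rw [← h1, ← sum_inner_single_mul (deriv γ (τ x)) (fderiv ℝ τ x)]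
      have : (n : ℝ) = ∑ i : Fin n, 1 := by simp
      rw [this, ← Finset.sum_sub_distrib]
      refine Finset.sum_congr rfl fun i _ => ?_
      simp only [ContinuousLinearMap.comp_apply, sub_apply,
        ContinuousLinearMap.id_apply, ContinuousLinearMap.smulRight_apply, innerSL_apply_apply,
        inner_sub_left, inner_smul_left, conj_trivial]
      rw [EuclideanSpace.inner_single_right]
      simp
      ring
    · filter_upwards [hτ.eventually (by simp), hF.eventually_nhds] with y hy hy'
      exact h.hasFDerivAt_half_sq_foot hy hy'.self_of_nhds

end IsEmbeddedLoop

/-- On the tube of radius `δ` about `Λ`, half of the squared distance to `Λ` and the curvature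
term `m` are of class `C²` and satisfy the identities of tubular coordinates. -/
structure TubeGeometry {n : ℕ} (Λ : Set (EuclideanSpace ℝ (Fin n))) (δ κ L : ℝ)
    (m : EuclideanSpace ℝ (Fin n) → ℝ) : Prop where
  contDiffAt_dist : ∀ x, infDist x Λ < δ → ContDiffAt ℝ 2 (fun y => infDist y Λ ^ 2 / 2) x
  contDiffAt_curv : ∀ x, infDist x Λ < δ → ContDiffAt ℝ 2 m x
  sum_sq : ∀ x, infDist x Λ < δ →
    ∑ i, fderiv ℝ (fun y => infDist y Λ ^ 2 / 2) x (EuclideanSpace.single i 1) ^ 2 =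
      infDist x Λ ^ 2
  sum_mul : ∀ x, infDist x Λ < δ →
    ∑ i, fderiv ℝ (fun y => infDist y Λ ^ 2 / 2) x (EuclideanSpace.single i 1) *
      fderiv ℝ m x (EuclideanSpace.single i 1) = m x
  lap_dist : ∀ x, infDist x Λ < δ → lap (fun y => infDist y Λ ^ 2 / 2) x = n - 1 / (1 - m x)
  abs_curv_le_half : ∀ x, infDist x Λ < δ → |m x| ≤ 1 / 2
  abs_curv_le : ∀ x, infDist x Λ < δ → |m x| ≤ κ * infDist x Λ
  abs_lap_curv_le : ∀ x, infDist x Λ < δ → |lap m x| ≤ L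

theorem IsEmbeddedLoop.exists_tubeGeometry {n : ℕ} {γ : ℝ → EuclideanSpace ℝ (Fin n)}
    (h : IsEmbeddedLoop γ) :
    ∃ δ κ L : ℝ, 0 < δ ∧ 0 ≤ κ ∧ 0 ≤ L ∧ ∃ m, TubeGeometry (range γ) δ κ L m := by
  obtain ⟨a, A, δ, ha, hA, hδ, hδA, hγ1, hγ2, huniq⟩ := h.exists_tubular_radius
  choose T hT hTF using h.exists_foot
  have hbound : ∀ x, |footCurv γ (T x) x| ≤ A / a * infDist x (range γ) := by
    intro x
    rw [footCurv_eq, abs_div, abs_of_pos (ha.trans_le (hγ1 (T x))), hT x]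
    have h1 : |inner ℝ (x - γ (T x)) (deriv (deriv γ) (T x))| ≤ ‖x - γ (T x)‖ * A :=
      (abs_real_inner_le_norm _ _).trans (by gcongr; exact hγ2 _)
    calc _ ≤ ‖x - γ (T x)‖ * A / a := div_le_div₀ (by positivity) h1 ha (hγ1 _)
      _ = _ := by ring
  have hhalf : ∀ x, infDist x (range γ) < δ → |footCurv γ (T x) x| ≤ 1 / 2 := by
    intro x hx
    refine (hbound x).trans ?_
    rw [div_mul_eq_mul_div, div_le_div_iff₀ ha two_pos]
    nlinarith
  have hloc : ∀ x, infDist x (range γ) < δ → ∃ τ : EuclideanSpace ℝ (Fin n) → ℝ,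
      τ x = T x ∧ ContDiffAt ℝ 2 τ x ∧
      (∀ᶠ y in 𝓝 x, inner ℝ (y - γ (τ y)) (deriv γ (τ y)) = 0) ∧
      (fun y => infDist y (range γ) ^ 2 / 2) =ᶠ[𝓝 x] (fun y => ‖y - γ (τ y)‖ ^ 2 / 2) ∧
      (fun y => footCurv γ (T y) y) =ᶠ[𝓝 x] fun y => footCurv γ (τ y) y := by
    intro x hx
    have hne : inner ℝ (x - γ (T x)) (deriv (deriv γ) (T x)) - ‖deriv γ (T x)‖ ^ 2 ≠ 0 := by
      have h1 : inner ℝ (x - γ (T x)) (deriv (deriv γ) (T x)) ≤ ‖x - γ (T x)‖ * A :=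
        (real_inner_le_norm _ _).trans (by gcongr; exact hγ2 _)
      rw [← hT x] at h1
      have := hγ1 (T x)
      nlinarith
    obtain ⟨τ, hτ0, hτ, hτF⟩ := h.exists_local_foot (hTF x) hne
    have hcont : ContinuousAt (fun y => ‖y - γ (τ y)‖) x :=
      (continuousAt_id.sub (h.smooth.continuous.continuousAt.comp hτ.continuousAt)).norm
    have hlt : ∀ᶠ y in 𝓝 x, ‖y - γ (τ y)‖ < δ :=
      hcont.eventually_lt_const (by simp only [hτ0, ← hT x]; exact hx)
    have hlt' : ∀ᶠ y in 𝓝 x, infDist y (range γ) < δ :=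
      (continuous_infDist_pt _).continuousAt.eventually_lt_const hx
    have hkint : ∀ᶠ y in 𝓝 x, ∃ k : ℤ, T y - τ y = k := by
      filter_upwards [hlt, hlt', hτF] with y h1 h2 h3
      exact huniq y _ _ (by rwa [← hT y]) h1 (hTF y) h3
    refine ⟨τ, hτ0, hτ, hτF, ?_, ?_⟩
    · filter_upwards [hkint] with y ⟨k, hk⟩
      rw [hT y, show τ y = T y - k by linarith, h.apply_sub_int]
    · filter_upwards [hkint] with y ⟨k, hk⟩
      have hp1 := h.periodic.deriv_one
      have e1 : deriv γ (T y - k) = deriv γ (T y) := by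
        simpa using hp1.sub_int_mul_eq k (x := T y)
      have e2 : deriv (deriv γ) (T y - k) = deriv (deriv γ) (T y) := by
        simpa using hp1.deriv_one.sub_int_mul_eq k (x := T y)
      rw [show τ y = T y - k by linarith, footCurv_eq, footCurv_eq, h.apply_sub_int, e1, e2]
  have hm : ∀ x, infDist x (range γ) < δ → ContDiffAt ℝ 2 (fun y => footCurv γ (T y) y) x := by
    intro x hx
    obtain ⟨τ, hτ0, hτ, hτF, -, he⟩ := hloc x hx
    have hh := hhalf x hx
    rw [← hτ0] at hh
    exact (h.local_geometry hτ hτF (by rw [abs_le] at hh; linarith)).2.1.congr_of_eventuallyEq he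
  have hcpt : IsCompact {x | infDist x (range γ) ≤ δ / 2} := by
    have hcomp : IsCompact (range γ) := h.periodic.compact_of_continuous one_ne_zero
      h.smooth.continuous
    refine (hcomp.cthickening (r := δ / 2)).of_isClosed_subset
      (isClosed_le (continuous_infDist_pt _) continuous_const) fun x hx =>
        mem_cthickening_of_dist_le x (γ (T x)) _ _ (mem_range_self _) ?_
    rw [dist_eq_norm, ← hT x]
    exact hx
  obtain ⟨L, hL⟩ := hcpt.exists_bound_of_continuousOn (f := lap fun y => footCurv γ (T y) y)
    fun x hx => (continuousAt_lap (hm x (by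
      have : infDist x (range γ) ≤ δ / 2 := hx
      linarith))).continuousWithinAt
  have hδ2 : δ / 2 < δ := by linarith
  refine ⟨δ / 2, A / a, |L|, by positivity, by positivity, abs_nonneg _,
    fun y => footCurv γ (T y) y, ?_, fun x hx => hm x (hx.trans hδ2), ?_, ?_, ?_,
    fun x hx => hhalf x (hx.trans hδ2), fun x _ => hbound x,
    fun x hx => (hL x hx.le).trans (le_abs_self L)⟩
  all_goals
    intro x hx
    have hx' := hx.trans hδ2
    obtain ⟨τ, hτ0, hτ, hτF, hd, he⟩ := hloc x hx'
    have hh := hhalf x hx'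
    rw [← hτ0] at hh
    obtain ⟨h1, h2, h3, h4, h5⟩ := h.local_geometry hτ hτF (by rw [abs_le] at hh; linarith)
  · exact h1.congr_of_eventuallyEq hd
  · rw [hd.fderiv_eq, h3, hτ0, hT]
  · rw [hd.fderiv_eq, he.fderiv_eq, h4, hτ0]
  · rw [lap_congr hd, h5, hτ0]

/-- The function `ρ ↦ F₀ (√(2ρ))`, with `√(2ρ)` truncated at `1`. -/
def radProfile (F₀ : ℝ → ℝ) (ρ : ℝ) : ℝ := F₀ (min (√(2 * ρ)) 1)

theorem radProfile_half_sq (F₀ : ℝ → ℝ) {r : ℝ} (hr : r ∈ Icc (0 : ℝ) 1) :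
    radProfile F₀ (r ^ 2 / 2) = F₀ r := by
  rw [radProfile, mul_div_cancel₀ _ two_ne_zero, sqrt_sq hr.1, min_eq_left hr.2]

theorem half_sq_mem {r : ℝ} (hr : r ∈ Ico (0 : ℝ) 1) : r ^ 2 / 2 ∈ Ico (0 : ℝ) (1 / 2) :=
  ⟨by positivity, by nlinarith [hr.1, hr.2]⟩

theorem exists_half_sq_eq {ρ : ℝ} (hρ : ρ ∈ Ico (0 : ℝ) (1 / 2)) :
    ∃ r ∈ Ico (0 : ℝ) 1, r ^ 2 / 2 = ρ := by
  refine ⟨√(2 * ρ), ⟨sqrt_nonneg _, ?_⟩, ?_⟩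
  · rw [sqrt_lt' one_pos]; linarith [hρ.2]
  · rw [sq_sqrt (by linarith [hρ.1])]; ring

theorem continuous_radProfile {d : ℕ} (hd : 1 ≤ d) {F : EuclideanSpace ℝ (Fin d) → ℝ}
    {F₀ : ℝ → ℝ} (hrad : ∀ z, F z = F₀ ‖z‖) (hF : ContDiffOn ℝ 2 F (closedBall 0 1)) :
    Continuous (radProfile F₀) := by
  set e : EuclideanSpace ℝ (Fin d) := EuclideanSpace.single ⟨0, hd⟩ 1 with he
  have hnorm : ∀ r : ℝ, 0 ≤ r → ‖r • e‖ = r := fun r hr => by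
    rw [norm_smul, he, PiLp.norm_single, norm_one, mul_one, norm_of_nonneg hr]
  have hmin : ∀ ρ : ℝ, 0 ≤ min (√(2 * ρ)) 1 := fun ρ => le_min (sqrt_nonneg _) zero_le_one
  have h1 : radProfile F₀ = fun ρ => F (min (√(2 * ρ)) 1 • e) := by
    funext ρ
    rw [radProfile, hrad, hnorm _ (hmin ρ)]
  rw [h1]
  refine hF.continuousOn.comp_continuous (by fun_prop) fun ρ => ?_
  rw [mem_closedBall_zero_iff, hnorm _ (hmin ρ)]
  exact min_le_right _ _

theorem radProfile_eqOn_radPrim {d : ℕ} (hd : 2 ≤ d) {F : EuclideanSpace ℝ (Fin d) → ℝ}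
    {F₀ : ℝ → ℝ} (hrad : ∀ z, F z = F₀ ‖z‖) (hF : ContDiffOn ℝ 2 F (closedBall 0 1))
    {g : ℝ → ℝ} (hg : Continuous g) (hsol : ∀ z ∈ ball 0 1, lap F z + g (‖z‖ ^ 2 / 2) = 0) :
    EqOn (radProfile F₀) (radPrim (d - 1) (F₀ 0) g) (Icc 0 (1 / 2)) := by
  have h1 : EqOn (radProfile F₀) (radPrim (d - 1) (F₀ 0) g) (Ico 0 (1 / 2)) := by
    intro ρ hρ
    obtain ⟨r, hr, rfl⟩ := exists_half_sq_eq hρ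
    rw [radProfile_half_sq F₀ ⟨hr.1, hr.2.le⟩, radial_profile hd hrad hF hg hsol r hr]
    rfl
  have h2 := h1.closure (continuous_radProfile (by omega) hrad hF)
    (continuous_iff_continuousAt.2 fun ρ => (hasDerivAt_radPrim _ _ hg ρ).continuousAt)
  rwa [closure_Ico (by norm_num)] at h2

namespace TubeGeometry

variable {n : ℕ} {Λ : Set (EuclideanSpace ℝ (Fin n))} {δ κ L : ℝ}
  {m : EuclideanSpace ℝ (Fin n) → ℝ}

theorem contDiffAt_scaled (hT : TubeGeometry Λ δ κ L m) (ε : ℝ) {x : EuclideanSpace ℝ (Fin n)}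
    (hx : infDist x Λ < δ) : ContDiffAt ℝ 2 (fun y => infDist y Λ ^ 2 / 2 / ε ^ 2) x :=
  (hT.contDiffAt_dist x hx).div_const _

theorem fderiv_scaled (hT : TubeGeometry Λ δ κ L m) (ε : ℝ) {x : EuclideanSpace ℝ (Fin n)}
    (hx : infDist x Λ < δ) : fderiv ℝ (fun y => infDist y Λ ^ 2 / 2 / ε ^ 2) x =
      (ε ^ 2)⁻¹ • fderiv ℝ (fun y => infDist y Λ ^ 2 / 2) x := by
  have h := ((hT.contDiffAt_dist x hx).differentiableAt (by norm_num)).hasFDerivAt.const_mul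
    (ε ^ 2)⁻¹
  rw [← h.fderiv]
  congr 1
  funext y
  ring

theorem lap_comp_dist (hT : TubeGeometry Λ δ κ L m) {ε : ℝ} (hε : ε ≠ 0)
    {x : EuclideanSpace ℝ (Fin n)} (hx : infDist x Λ < δ) {φ φ' : ℝ → ℝ} {φ'' : ℝ}
    (hφ : ∀ t, HasDerivAt φ (φ' t) t)
    (hφ' : HasDerivAt φ' φ'' (infDist x Λ ^ 2 / 2 / ε ^ 2)) :
    ε ^ 2 * lap (fun y => φ (infDist y Λ ^ 2 / 2 / ε ^ 2)) x =
      2 * (infDist x Λ ^ 2 / 2 / ε ^ 2) * φ'' +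
        (n - 1 / (1 - m x)) * φ' (infDist x Λ ^ 2 / 2 / ε ^ 2) := by
  set c := (ε ^ 2)⁻¹ with hc
  have hcε : ε ^ 2 * c = 1 := mul_inv_cancel₀ (pow_ne_zero 2 hε)
  have hφc : ∀ t, HasDerivAt (fun t => φ (t * c)) (φ' (t * c) * c) t := fun t =>
    (hφ (t * c)).comp t (hasDerivAt_mul_const c)
  have hφc' : HasDerivAt (fun t => φ' (t * c) * c) (φ'' * c * c) (infDist x Λ ^ 2 / 2) := by
    rw [div_eq_mul_inv _ (ε ^ 2)] at hφ'
    exact (HasDerivAt.comp (infDist x Λ ^ 2 / 2) hφ' (hasDerivAt_mul_const c)).mul_const c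
  simp only [div_eq_mul_inv _ (ε ^ 2), ← hc]
  rw [lap_comp (hT.contDiffAt_dist x hx) hφc hφc', hT.sum_sq x hx, hT.lap_dist x hx]
  linear_combination (φ'' * c * infDist x Λ ^ 2 +
    φ' (infDist x Λ ^ 2 / 2 * c) * (n - 1 / (1 - m x))) * hcε

theorem lap_comp_mul_curv (hT : TubeGeometry Λ δ κ L m) {ε : ℝ} (hε : ε ≠ 0)
    {x : EuclideanSpace ℝ (Fin n)} (hx : infDist x Λ < δ) {G G' : ℝ → ℝ} {G'' : ℝ}
    (hGC : ContDiff ℝ 2 G) (hG : ∀ t, HasDerivAt G (G' t) t)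
    (hG' : HasDerivAt G' G'' (infDist x Λ ^ 2 / 2 / ε ^ 2)) :
    ε ^ 2 * lap (fun y => G (infDist y Λ ^ 2 / 2 / ε ^ 2) * m y) x =
      ε ^ 2 * G (infDist x Λ ^ 2 / 2 / ε ^ 2) * lap m x +
      m x * (2 * (infDist x Λ ^ 2 / 2 / ε ^ 2) * G'' +
        (n - 1 / (1 - m x) + 2) * G' (infDist x Λ ^ 2 / 2 / ε ^ 2)) := by
  have hρ := hT.contDiffAt_scaled ε hx
  have hGρ : ContDiffAt ℝ 2 (fun y => G (infDist y Λ ^ 2 / 2 / ε ^ 2)) x :=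
    hGC.contDiffAt.comp x hρ
  have hfd := ((hG (infDist x Λ ^ 2 / 2 / ε ^ 2)).comp_hasFDerivAt x
    (hρ.differentiableAt (by norm_num)).hasFDerivAt).fderiv
  have hfd' : fderiv ℝ (fun y => G (infDist y Λ ^ 2 / 2 / ε ^ 2)) x = _ := hfd
  have h1 := hT.lap_comp_dist hε hx hG hG'
  have hsum : ε ^ 2 * ∑ i, fderiv ℝ (fun y => G (infDist y Λ ^ 2 / 2 / ε ^ 2)) x
      (EuclideanSpace.single i 1) * fderiv ℝ m x (EuclideanSpace.single i 1) =
        G' (infDist x Λ ^ 2 / 2 / ε ^ 2) * m x := by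
    conv_rhs => rw [← hT.sum_mul x hx]
    rw [hfd', hT.fderiv_scaled ε hx, Finset.mul_sum, Finset.mul_sum]
    refine Finset.sum_congr rfl fun i _ => ?_
    simp only [smul_apply, smul_eq_mul]
    field_simp
  rw [lap_mul hGρ (hT.contDiffAt_curv x hx)]
  linear_combination m x * h1 + 2 * hsum

end TubeGeometry

theorem isOpen_tube {n : ℕ} (Λ : Set (EuclideanSpace ℝ (Fin n))) (ε : ℝ) : IsOpen (tube Λ ε) :=
  isOpen_lt (continuous_infDist_pt _) continuous_const

theorem infDist_le_of_mem_closure_tube {n : ℕ} {Λ : Set (EuclideanSpace ℝ (Fin n))} {ε : ℝ}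
    {x : EuclideanSpace ℝ (Fin n)} (hx : x ∈ closure (tube Λ ε)) : infDist x Λ ≤ ε :=
  closure_lt_subset_le (continuous_infDist_pt _) continuous_const hx

theorem infDist_eq_of_mem_frontier_tube {n : ℕ} {Λ : Set (EuclideanSpace ℝ (Fin n))} {ε : ℝ}
    {x : EuclideanSpace ℝ (Fin n)} (hx : x ∈ frontier (tube Λ ε)) : infDist x Λ = ε :=
  frontier_lt_subset_eq (continuous_infDist_pt _) continuous_const hx

theorem contDiffAt_of_mem_tube {n : ℕ} {Λ : Set (EuclideanSpace ℝ (Fin n))} {ε : ℝ}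
    {φ : EuclideanSpace ℝ (Fin n) → ℝ} (hφ : ContDiffOn ℝ 2 φ (closure (tube Λ ε)))
    {x : EuclideanSpace ℝ (Fin n)} (hx : x ∈ tube Λ ε) : ContDiffAt ℝ 2 φ x :=
  hφ.contDiffAt (mem_of_superset ((isOpen_tube Λ ε).mem_nhds hx) subset_closure)

theorem exists_infDist_eq {n : ℕ} (hn : 1 ≤ n) {Λ : Set (EuclideanSpace ℝ (Fin n))}
    (hΛ : IsCompact Λ) (hne : Λ.Nonempty) {r : ℝ} (hr : 0 ≤ r) : ∃ x, infDist x Λ = r := by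
  obtain ⟨R, hR⟩ := hΛ.isBounded.exists_norm_le
  obtain ⟨p, hp⟩ := hne
  refine mem_range_of_exists_le_of_exists_ge (continuous_infDist_pt Λ)
    ⟨p, by rw [infDist_zero_of_mem hp]; exact hr⟩
    ⟨EuclideanSpace.single ⟨0, hn⟩ (R + r), (le_infDist ⟨p, hp⟩).2 fun y hy => ?_⟩
  have h0 : 0 ≤ R := (norm_nonneg p).trans (hR p hp)
  have h1 := norm_sub_norm_le (EuclideanSpace.single ⟨0, hn⟩ (R + r)) y
  rw [PiLp.norm_single, norm_of_nonneg (by positivity), ← dist_eq_norm] at h1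
  linarith [hR y hy]

theorem abs_exp_remainder_sub_le {a b c : ℝ} (hc : c ≤ 1) (ha : |a| ≤ c) (hb : |b| ≤ c) :
    |(exp a - 1 - a) - (exp b - 1 - b)| ≤ 2 * c * |a - b| := by
  have h := (convex_Icc (-c) c).norm_image_sub_le_of_norm_hasDerivWithin_le
    (f := fun t => exp t - 1 - t) (f' := fun t => exp t - 1) (C := 2 * c)
    (fun t _ => (((Real.hasDerivAt_exp t).sub_const 1).sub (hasDerivAt_id t)).hasDerivWithinAt)
    (fun t ht => by
      have h1 := abs_le.2 ht
      have := Real.abs_exp_sub_one_le (h1.trans hc)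
      rw [norm_eq_abs]
      linarith) (abs_le.1 hb) (abs_le.1 ha)
  simpa [norm_eq_abs] using h

theorem exists_profiles {d : ℕ} (hd : 2 ≤ d) {lam : ℝ} (hlam : 0 < lam)
    {U : EuclideanSpace ℝ (Fin d) → ℝ} {U₀ : ℝ → ℝ} (hUrad : ∀ z, U z = U₀ ‖z‖)
    (hUC2 : ContDiffOn ℝ 2 U (closedBall 0 1))
    (hUsol : ∀ z ∈ ball 0 1, lap U z + lam * exp (U z) = 0)
    {W : EuclideanSpace ℝ (Fin d) → ℝ} {W₀ : ℝ → ℝ} (hWrad : ∀ z, W z = W₀ ‖z‖)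
    (hWC2 : ContDiffOn ℝ 2 W (closedBall 0 1))
    (hWsol : ∀ z ∈ ball 0 1, -(lap W z) - lam * exp (U z) * W z = 1) :
    ∃ V P g w Y Y' : ℝ → ℝ, GelfandProfile d lam V P g ∧
      (∀ r ∈ Ico (0 : ℝ) 1, U₀ r = V (r ^ 2 / 2)) ∧
      (∀ r ∈ Ico (0 : ℝ) 1, W₀ r = w (r ^ 2 / 2)) ∧
      (∀ ρ, HasDerivAt w (-Y ρ) ρ) ∧ (∀ ρ, HasDerivAt Y (Y' ρ) ρ) ∧
      ∀ ρ ∈ Icc (0 : ℝ) (1 / 2), 2 * ρ * Y' ρ + d * Y ρ = g ρ * w ρ + 1 := by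
  have hUc := continuous_radProfile (by omega) hUrad hUC2
  have hWc := continuous_radProfile (by omega) hWrad hWC2
  have hU₀ : ∀ z ∈ ball (0 : EuclideanSpace ℝ (Fin d)) 1, U z = radProfile U₀ (‖z‖ ^ 2 / 2) :=
    fun z hz => by
      rw [mem_ball_zero_iff] at hz
      rw [hUrad, radProfile_half_sq _ ⟨norm_nonneg z, hz.le⟩]
  have hW₀ : ∀ z ∈ ball (0 : EuclideanSpace ℝ (Fin d)) 1, W z = radProfile W₀ (‖z‖ ^ 2 / 2) :=
    fun z hz => by
      rw [mem_ball_zero_iff] at hz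
      rw [hWrad, radProfile_half_sq _ ⟨norm_nonneg z, hz.le⟩]
  obtain ⟨V, P, g, hp, hV⟩ := exists_gelfandProfile (by omega) hlam hUc
    (radProfile_eqOn_radPrim hd hUrad hUC2 (continuous_const.mul hUc.rexp) fun z hz => by
      rw [← hU₀ z hz]
      exact hUsol z hz)
  obtain ⟨w, Y, Y', hw, hw', hY, hode⟩ := exists_torsionProfile (by omega) hp.contDiff_g hWc
    (radProfile_eqOn_radPrim hd hWrad hWC2
      ((hp.contDiff_g.continuous.mul hWc).add continuous_const) fun z hz => by
        have hρ : ‖z‖ ^ 2 / 2 ∈ Icc (0 : ℝ) (1 / 2) :=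
          Ico_subset_Icc_self (half_sq_mem ⟨norm_nonneg z, mem_ball_zero_iff.1 hz⟩)
        rw [← hW₀ z hz, hp.g_eq _ hρ, hV hρ, ← hU₀ z hz]
        linarith [hWsol z hz])
  refine ⟨V, P, g, w, Y, Y', hp, fun r hr => ?_, fun r hr => ?_, hw', hY, hode⟩
  · rw [hV (Ico_subset_Icc_self (half_sq_mem hr)), radProfile_half_sq _ ⟨hr.1, hr.2.le⟩]
  · rw [hw (Ico_subset_Icc_self (half_sq_mem hr)), radProfile_half_sq _ ⟨hr.1, hr.2.le⟩]

theorem exists_common_bound {f₁ f₂ f₃ f₄ f₅ : ℝ → ℝ} (h₁ : Continuous f₁) (h₂ : Continuous f₂)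
    (h₃ : Continuous f₃) (h₄ : Continuous f₄) (h₅ : Continuous f₅) :
    ∃ B > 0, ∀ ρ ∈ Icc (0 : ℝ) (1 / 2),
      |f₁ ρ| ≤ B ∧ |f₂ ρ| ≤ B ∧ |f₃ ρ| ≤ B ∧ |f₄ ρ| ≤ B ∧ |f₅ ρ| ≤ B := by
  obtain ⟨B, hB⟩ := isCompact_Icc (a := (0 : ℝ)) (b := 1 / 2).exists_bound_of_continuousOn
    (f := fun ρ => |f₁ ρ| + |f₂ ρ| + |f₃ ρ| + |f₄ ρ| + |f₅ ρ|)
    (by fun_prop : Continuous _).continuousOn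
  refine ⟨|B| + 1, by positivity, fun ρ hρ => ?_⟩
  have h := (le_abs_self _).trans ((hB ρ hρ).trans (le_abs_self B))
  have := abs_nonneg (f₁ ρ)
  have := abs_nonneg (f₂ ρ)
  have := abs_nonneg (f₃ ρ)
  have := abs_nonneg (f₄ ρ)
  have := abs_nonneg (f₅ ρ)
  refine ⟨?_, ?_, ?_, ?_, ?_⟩ <;> linarith

/-- The first order expansion of the residual and of its preimage under the linearized operator:
with `p, G, G'` the profile values, the corrector solves the equation up to `O(ε²)`. -/
theorem corrector_error_le {p G G' g G'' m ℓ ρ ε κ L B N d : ℝ} (hε : 0 < ε)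
    (hm2 : |m| ≤ 1 / 2) (hmκ : |m| ≤ κ * ε) (hℓ : |ℓ| ≤ L) (hp : |p| ≤ B) (hG : |G| ≤ B)
    (hG' : |G'| ≤ B) (hN : N = d + 1)
    (hode : 2 * ρ * G'' + (d + 2) * G' + g * G = -p) :
    |p * m / (1 - m) + (ε ^ 2 * G * ℓ +
      m * (2 * ρ * G'' + (N - 1 / (1 - m) + 2) * G') + g * (G * m))| ≤
        ε ^ 2 * (4 * B * κ ^ 2 + B * L) := by
  have hB : 0 ≤ B := (abs_nonneg _).trans hp
  rw [abs_le] at hm2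
  have h1 : (1 : ℝ) / 2 ≤ 1 - m := by linarith
  have h10 : 1 - m ≠ 0 := by linarith
  have hid : p * m / (1 - m) + (ε ^ 2 * G * ℓ +
      m * (2 * ρ * G'' + (N - 1 / (1 - m) + 2) * G') + g * (G * m)) =
        ε ^ 2 * (G * ℓ) + (p - G') * (m ^ 2 / (1 - m)) := by
    rw [hN]
    field_simp
    linear_combination m * (1 - m) * hode
  have h2 : |G * ℓ| ≤ B * L := by rw [abs_mul]; gcongr
  have h3 : |p - G'| ≤ 2 * B := (abs_sub p G').trans (by linarith)
  have h4 : |m ^ 2 / (1 - m)| ≤ 2 * (κ * ε) ^ 2 := by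
    have hsq : m ^ 2 ≤ (κ * ε) ^ 2 := by
      rw [← sq_abs m]
      gcongr
    rw [abs_of_nonneg (by positivity), div_le_iff₀ (by linarith)]
    nlinarith [sq_nonneg (κ * ε)]
  rw [hid]
  calc _ ≤ |ε ^ 2 * (G * ℓ)| + |(p - G') * (m ^ 2 / (1 - m))| := abs_add_le _ _
    _ ≤ ε ^ 2 * (B * L) + 2 * B * (2 * (κ * ε) ^ 2) := by
        rw [abs_mul, abs_mul (p - G'), abs_of_pos (by positivity : 0 < ε ^ 2)]
        gcongr
    _ = _ := by ring

/-- With `u_ε(x) = U(dist(x,Λ)/ε)`, `w_ε(x) = W(dist(x,Λ)/ε)`, and with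
`C` the constant for which the inverse bound `‖L_ε⁻¹ h‖_∞ ≤ 2‖h‖_∞ w_ε` and the residual
bound `|ε² Δu_ε + λ e^{u_ε}| ≤ C ε` hold, the map
`H_ε(v) = L_ε⁻¹((ε² Δu_ε + λ e^{u_ε}) + λ e^{u_ε}(e^v − 1 − v))` satisfies, for some
`C' > 0` and all small `ε` and all `f, g ∈ 𝒜_ε = {‖v‖_∞ ≤ Cε}`:
`‖H_ε f‖_∞ ≤ Cε` (it maps `𝒜_ε` into itself) and
`‖H_ε f − H_ε g‖_∞ ≤ C' ε ‖f − g‖_∞` (it is a contraction). `H_ε f` is encoded as the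
solution `φf` of `L_ε φf = (ε² Δu_ε + λ e^{u_ε}) + λ e^{u_ε}(e^f − 1 − f)` with zero
Dirichlet data. -/
theorem tube_fixed_point_map_contraction
    (n : ℕ) (hn : 3 ≤ n)
    -- `Λ = range γ` is a smooth closed curve embedded in `ℝⁿ`
    (γ : ℝ → EuclideanSpace ℝ (Fin n)) (hγ_smooth : ContDiff ℝ (⊤ : ℕ∞) γ)
    (hγ_per : Function.Periodic γ 1)
    (hγ_reg : ∀ t : ℝ, deriv γ t ≠ 0)
    (hγ_inj : ∀ s t : ℝ, γ s = γ t → ∃ k : ℤ, s - t = (k : ℝ))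
    (Λ : Set (EuclideanSpace ℝ (Fin n))) (hΛ : Λ = Set.range γ)
    (lam : ℝ) (hlam : 0 < lam)
    -- `U` is a radial stable solution of the Gelfand problem in `B^{n-1}`, of profile `U₀`
    (U : EuclideanSpace ℝ (Fin (n - 1)) → ℝ) (U₀ : ℝ → ℝ)
    (hUrad : ∀ z : EuclideanSpace ℝ (Fin (n - 1)), U z = U₀ ‖z‖)
    (hUC2 : ContDiffOn ℝ 2 U (closedBall (0 : EuclideanSpace ℝ (Fin (n - 1))) 1))
    (hUsol : ∀ z ∈ ball (0 : EuclideanSpace ℝ (Fin (n - 1))) 1, lap U z + lam * exp (U z) = 0)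
    (hUbdry : ∀ z ∈ sphere (0 : EuclideanSpace ℝ (Fin (n - 1))) 1, U z = 0)
    -- `W` is the radial solution of `−ΔW − λ e^U W = 1` in `B^{n-1}`, of profile `W₀`
    (W : EuclideanSpace ℝ (Fin (n - 1)) → ℝ) (W₀ : ℝ → ℝ)
    (hWrad : ∀ z : EuclideanSpace ℝ (Fin (n - 1)), W z = W₀ ‖z‖)
    (hWC2 : ContDiffOn ℝ 2 W (closedBall (0 : EuclideanSpace ℝ (Fin (n - 1))) 1))
    (hWsol : ∀ z ∈ ball (0 : EuclideanSpace ℝ (Fin (n - 1))) 1,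
      -(lap W z) - lam * exp (U z) * W z = 1)
    (hWbdry : ∀ z ∈ sphere (0 : EuclideanSpace ℝ (Fin (n - 1))) 1, W z = 0)
    (C : ℝ) (hC : 0 < C) (ε₁ : ℝ) (hε₁ : 0 < ε₁)
    -- the a priori bound `‖L_ε⁻¹ h‖_∞ ≤ 2‖h‖_∞ w_ε` for the linearized operator
    (hinv : ∀ ε : ℝ, 0 < ε → ε < ε₁ →
      ∀ φ h : EuclideanSpace ℝ (Fin n) → ℝ,
        ContDiffOn ℝ 2 φ (closure (tube Λ ε)) →
        (∀ x ∈ tube Λ ε,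
          -(ε ^ 2 * lap φ x + lam * exp (U₀ (Metric.infDist x Λ / ε)) * φ x) = h x) →
        (∀ x ∈ frontier (tube Λ ε), φ x = 0) →
        ∀ M : ℝ, 0 ≤ M → (∀ x ∈ tube Λ ε, |h x| ≤ M) →
          ∀ x ∈ tube Λ ε, |φ x| ≤ 2 * M * W₀ (Metric.infDist x Λ / ε))
    -- the residual bound `|ε² Δu_ε + λ e^{u_ε}| ≤ C ε`
    (hres : ∀ ε : ℝ, 0 < ε → ε < ε₁ → ∀ x ∈ tube Λ ε,
      |ε ^ 2 * lap (fun y => U₀ (Metric.infDist y Λ / ε)) x +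
          lam * exp (U₀ (Metric.infDist x Λ / ε))| ≤ C * ε) :
    ∃ C' > (0 : ℝ), ∃ ε₀ > (0 : ℝ), ε₀ ≤ ε₁ ∧ ∀ ε : ℝ, 0 < ε → ε < ε₀ →
      ∀ f g φf φg : EuclideanSpace ℝ (Fin n) → ℝ,
        -- `f, g ∈ 𝒜_ε`
        (∀ x ∈ tube Λ ε, |f x| ≤ C * ε) →
        (∀ x ∈ tube Λ ε, |g x| ≤ C * ε) →
        -- `φf = H_ε f`
        ContDiffOn ℝ 2 φf (closure (tube Λ ε)) →
        (∀ x ∈ tube Λ ε,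
          -(ε ^ 2 * lap φf x + lam * exp (U₀ (Metric.infDist x Λ / ε)) * φf x) =
            (ε ^ 2 * lap (fun y => U₀ (Metric.infDist y Λ / ε)) x +
              lam * exp (U₀ (Metric.infDist x Λ / ε))) +
            lam * exp (U₀ (Metric.infDist x Λ / ε)) * (Real.exp (f x) - 1 - f x)) →
        (∀ x ∈ frontier (tube Λ ε), φf x = 0) →
        -- `φg = H_ε g`
        ContDiffOn ℝ 2 φg (closure (tube Λ ε)) →
        (∀ x ∈ tube Λ ε,
          -(ε ^ 2 * lap φg x + lam * exp (U₀ (Metric.infDist x Λ / ε)) * φg x) =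
            (ε ^ 2 * lap (fun y => U₀ (Metric.infDist y Λ / ε)) x +
              lam * exp (U₀ (Metric.infDist x Λ / ε))) +
            lam * exp (U₀ (Metric.infDist x Λ / ε)) * (Real.exp (g x) - 1 - g x)) →
        (∀ x ∈ frontier (tube Λ ε), φg x = 0) →
        -- `H_ε` maps `𝒜_ε` into itself and is a contraction there
        (∀ x ∈ tube Λ ε, |φf x| ≤ C * ε) ∧
        (∀ M : ℝ, 0 ≤ M → (∀ x ∈ tube Λ ε, |f x - g x| ≤ M) →
          ∀ x ∈ tube Λ ε, |φf x - φg x| ≤ C' * ε * M) := by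
  have hloop : IsEmbeddedLoop γ := ⟨hγ_smooth, hγ_per, hγ_reg, hγ_inj⟩
  have hΛc : IsCompact Λ := hΛ ▸ hγ_per.compact_of_continuous one_ne_zero hγ_smooth.continuous
  have hΛne : Λ.Nonempty := hΛ ▸ range_nonempty γ
  obtain ⟨δ, κ, L, hδ, hκ, hL, m, hT⟩ := hloop.exists_tubeGeometry
  rw [← hΛ] at hT
  obtain ⟨V, P, g, w, Y, Y', hp, hUV, hWw, hw, hY, hode⟩ :=
    exists_profiles (by omega) hlam hUrad hUC2 hUsol hWrad hWC2 hWsol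
  have hw0 : ∀ ρ ∈ Ico (0 : ℝ) (1 / 2), 0 ≤ w ρ := by
    intro ρ hρ
    obtain ⟨r, hr, rfl⟩ := exists_half_sq_eq hρ
    obtain ⟨x, hx⟩ := exists_infDist_eq (by omega : 1 ≤ n) hΛc hΛne
      (r := r * (ε₁ / 2)) (by have := hr.1; positivity)
    have h1 := hinv (ε₁ / 2) (by linarith) (by linarith) (fun _ => 0) (fun _ => 0)
      contDiffOn_const (fun x _ => by simp [lap_eq_sum_fderiv]) (fun _ _ => rfl) 1 zero_le_one
      (fun _ _ => by simp) x (by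
        change infDist x Λ < _
        rw [hx]
        nlinarith [hr.2])
    rw [hx, mul_div_cancel_right₀ _ (by linarith : ε₁ / 2 ≠ 0), hWw r hr, abs_zero] at h1
    linarith
  obtain ⟨h, G', G'', hhC, hh1, hh2, hG'c, hG, hG', hGode⟩ :=
    hp.exists_corrector (by omega) (hp.mul_P_lt_one (by omega) hw hY hode hw0)
  have hGC : ContDiff ℝ 2 fun ρ => P ρ * h ρ := hp.contDiff_P.mul hhC
  obtain ⟨B, hB, hbd⟩ := exists_common_bound hp.contDiff_P.continuous hGC.continuous hG'c
    hp.contDiff_g.continuous (continuous_iff_continuousAt.2 fun ρ => (hw ρ).continuousAt)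
  set Q := 4 * B * κ ^ 2 + B * L + B * C ^ 2 with hQ
  have hQ0 : 0 ≤ Q := by positivity
  refine ⟨4 * B * C * B, by positivity, min (min ε₁ δ) (min (1 / C) (C / (C * κ + 4 * Q * B + 1))),
    by positivity, (min_le_left _ _).trans (min_le_left _ _), ?_⟩
  intro ε hε hε₀ f k φf φk hf hk hφf hφfeq hφf0 hφk hφkeq hφk0
  have hεε₁ : ε < ε₁ := hε₀.trans_le ((min_le_left _ _).trans (min_le_left _ _))
  have hεδ : ε < δ := hε₀.trans_le ((min_le_left _ _).trans (min_le_right _ _))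
  have hεC : C * ε ≤ 1 := by
    have := hε₀.trans_le ((min_le_right _ _).trans (min_le_left _ _))
    rw [lt_div_iff₀ hC] at this
    linarith
  have hεQ : ε * (C * κ + 4 * Q * B) ≤ C := by
    have := hε₀.trans_le ((min_le_right _ _).trans (min_le_right _ _))
    rw [lt_div_iff₀ (by positivity)] at this
    linarith
  have hmem : ∀ x ∈ tube Λ ε, infDist x Λ / ε ∈ Ico (0 : ℝ) 1 := fun x hx =>
    ⟨div_nonneg infDist_nonneg hε.le, (div_lt_one hε).2 hx⟩
  have hsq : ∀ x, infDist x Λ ^ 2 / 2 / ε ^ 2 = (infDist x Λ / ε) ^ 2 / 2 := fun x => by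
    field_simp
  have hρ : ∀ x ∈ tube Λ ε, infDist x Λ ^ 2 / 2 / ε ^ 2 ∈ Icc (0 : ℝ) (1 / 2) := fun x hx =>
    hsq x ▸ Ico_subset_Icc_self (half_sq_mem (hmem x hx))
  have hgx : ∀ x ∈ tube Λ ε, lam * exp (U₀ (infDist x Λ / ε)) =
      g (infDist x Λ ^ 2 / 2 / ε ^ 2) := fun x hx => by
    rw [hp.g_eq _ (hρ x hx), hUV _ (hmem x hx), hsq]
  have hWx : ∀ x ∈ tube Λ ε, W₀ (infDist x Λ / ε) ≤ B := fun x hx => by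
    rw [hWw _ (hmem x hx), ← hsq]
    exact (le_abs_self _).trans (hbd _ (hρ x hx)).2.2.2.2
  have hinv' : ∀ φ ψ : EuclideanSpace ℝ (Fin n) → ℝ,
      ContDiffOn ℝ 2 φ (closure (tube Λ ε)) → ContDiffOn ℝ 2 ψ (closure (tube Λ ε)) →
      (∀ x ∈ frontier (tube Λ ε), φ x = 0) → (∀ x ∈ frontier (tube Λ ε), ψ x = 0) →
      ∀ M : ℝ, 0 ≤ M → (∀ x ∈ tube Λ ε,
        |-(ε ^ 2 * lap φ x + lam * exp (U₀ (infDist x Λ / ε)) * φ x) +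
          (ε ^ 2 * lap ψ x + lam * exp (U₀ (infDist x Λ / ε)) * ψ x)| ≤ M) →
      ∀ x ∈ tube Λ ε, |φ x - ψ x| ≤ 2 * M * B := by
    intro φ ψ hφ hψ hφ0 hψ0 M hM hle x hx
    refine (hinv ε hε hεε₁ (fun y => φ y - ψ y)
      (fun y => -(ε ^ 2 * lap φ y + lam * exp (U₀ (infDist y Λ / ε)) * φ y) +
        (ε ^ 2 * lap ψ y + lam * exp (U₀ (infDist y Λ / ε)) * ψ y)) (hφ.sub hψ)
      (fun y hy => ?_) (fun y hy => by simp only [hφ0 y hy, hψ0 y hy, sub_zero]) M hM hle x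
      hx).trans (by have := hWx x hx; gcongr)
    rw [lap_sub (contDiffAt_of_mem_tube hφ hy) (contDiffAt_of_mem_tube hψ hy)]
    ring
  have hgB : ∀ x ∈ tube Λ ε, |lam * exp (U₀ (infDist x Λ / ε))| ≤ B := fun x hx => by
    rw [hgx x hx]
    exact (hbd _ (hρ x hx)).2.2.2.1
  constructor
  · set ψ : EuclideanSpace ℝ (Fin n) → ℝ := fun y =>
      P (infDist y Λ ^ 2 / 2 / ε ^ 2) * h (infDist y Λ ^ 2 / 2 / ε ^ 2) * m y with hψ
    have hψC : ContDiffOn ℝ 2 ψ (closure (tube Λ ε)) := fun x hx => by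
      have hx' : infDist x Λ < δ := (infDist_le_of_mem_closure_tube hx).trans_lt hεδ
      exact ((hGC.contDiffAt.comp x (hT.contDiffAt_scaled ε hx')).mul
        (hT.contDiffAt_curv x hx')).contDiffWithinAt
    have hψ0 : ∀ x ∈ frontier (tube Λ ε), ψ x = 0 := fun x hx => by
      have h1 : ε ^ 2 / 2 / ε ^ 2 = 1 / 2 := by field_simp
      simp only [hψ, infDist_eq_of_mem_frontier_tube hx, h1, hh1, mul_zero, zero_mul]
    have hresid : ∀ x ∈ tube Λ ε, ε ^ 2 * lap (fun y => U₀ (infDist y Λ / ε)) x +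
        lam * exp (U₀ (infDist x Λ / ε)) =
          P (infDist x Λ ^ 2 / 2 / ε ^ 2) * m x / (1 - m x) := by
      intro x hx
      have hx' : infDist x Λ < δ := lt_trans hx hεδ
      have he : (fun y => U₀ (infDist y Λ / ε)) =ᶠ[𝓝 x]
          fun y => V (infDist y Λ ^ 2 / 2 / ε ^ 2) := by
        filter_upwards [(isOpen_tube Λ ε).mem_nhds hx] with y hy
        rw [hUV _ (hmem y hy), hsq]
      have hm := abs_le.1 (hT.abs_curv_le_half x hx')
      have hm1 : 1 - m x ≠ 0 := by linarith
      have hd : ((n - 1 : ℕ) : ℝ) = n - 1 := by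
        rw [Nat.cast_sub (by omega)]
        simp
      rw [lap_congr he, hT.lap_comp_dist hε.ne' hx' hp.deriv_V (hp.hasDerivAt_P _).neg, hgx x hx,
        ← hp.ode, hd]
      field_simp
      ring
    intro x hx
    have hx' : infDist x Λ < δ := lt_trans hx hεδ
    have hdiff := hinv' φf ψ hφf hψC hφf0 hψ0 (ε ^ 2 * Q) (by positivity) (fun y hy => by
      have hy' : infDist y Λ < δ := lt_trans hy hεδ
      obtain ⟨b1, b2, b3, b4, -⟩ := hbd _ (hρ y hy)
      have hκε : |m y| ≤ κ * ε :=
        (hT.abs_curv_le y hy').trans (by gcongr; exact (show infDist y Λ < ε from hy).le)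
      have e1 := corrector_error_le (N := n) (d := ((n - 1 : ℕ) : ℝ)) hε
        (hT.abs_curv_le_half y hy') hκε (hT.abs_lap_curv_le y hy') b1 b2 b3
        (by rw [Nat.cast_sub (by omega)]; simp) (hGode _ (hρ y hy))
      have e2 : |exp (f y) - 1 - f y| ≤ (C * ε) ^ 2 := by
        refine (Real.abs_exp_sub_one_sub_id_le ((hf y hy).trans hεC)).trans ?_
        rw [← sq_abs]
        have := hf y hy
        gcongr
      have e3 : |g (infDist y Λ ^ 2 / 2 / ε ^ 2) * (exp (f y) - 1 - f y)| ≤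
          B * (C * ε) ^ 2 := by
        rw [abs_mul]
        gcongr
      rw [hφfeq y hy, hresid y hy, hgx y hy, hψ,
        hT.lap_comp_mul_curv hε.ne' hy' hGC hG (hG' _)]
      rw [add_right_comm]
      refine (abs_add_le _ _).trans ((add_le_add e1 e3).trans_eq ?_)
      rw [hQ]
      ring) x hx
    have hψle : |ψ x| ≤ C * ε * (1 + κ * ε) / 2 := by
      have hm := abs_le.1 (hT.abs_curv_le_half x hx')
      have hm1 : 1 - m x ≠ 0 := by linarith
      have hκε : |m x| ≤ κ * ε :=
        (hT.abs_curv_le x hx').trans (by gcongr; exact (show infDist x Λ < ε from hx).le)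
      have h1 := hres ε hε hεε₁ x hx
      rw [hresid x hx] at h1
      have h2 : |1 - m x| ≤ 1 + κ * ε := by
        refine (abs_sub _ _).trans ?_
        rw [abs_one]
        gcongr
      have h3 : ψ x = P (infDist x Λ ^ 2 / 2 / ε ^ 2) * m x / (1 - m x) * (1 - m x) *
          h (infDist x Λ ^ 2 / 2 / ε ^ 2) := by
        rw [div_mul_cancel₀ _ hm1, hψ]
        ring
      rw [h3, abs_mul, abs_mul]
      have h4 := hh2 _ (hρ x hx)
      calc _ ≤ C * ε * (1 + κ * ε) * (1 / 2) := by gcongr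
        _ = _ := by ring
    have h5 : |φf x| ≤ |φf x - ψ x| + |ψ x| := by
      simpa using abs_add_le (φf x - ψ x) (ψ x)
    nlinarith
  · intro M hM hfk x hx
    refine (hinv' φf φk hφf hφk hφf0 hφk0 (B * (2 * (C * ε) * M)) (by positivity)
      (fun y hy => ?_) x hx).trans_eq (by ring)
    have e1 := abs_exp_remainder_sub_le hεC (hf y hy) (hk y hy)
    have e2 := hφkeq y hy
    rw [hφfeq y hy]
    have e3 : ∀ a b c : ℝ, -b = c → a + b = a - c := fun a b c h => by rw [← h]; ring
    rw [e3 _ _ _ e2, add_sub_add_left_eq_sub, ← mul_sub, abs_mul]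
    have e4 := hgB y hy
    have e5 := hfk y hy
    calc _ ≤ B * (2 * (C * ε) * |f y - k y|) := by gcongr
      _ ≤ _ := by gcongr
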